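/- Let R be a commutative Noetherian ring, M a finitely generated R-module of finite dimension d, and P a finite set of maximal ideals of R. Let 𝔐 = ∩_{m ∈ P} m and let T denote the 𝔐-adic completion of R. Let a and b be ideals of R with Supp_R H^d_a(M) = Supp_R H^d_b(M) = P. If either a ⊆ b, or Att_T H^d_a(M) ⊆ Att_T H^d_b(M) (for the natural T-module structures these Artinian R-modules carry), then H^d_a(M) is isomorphic as an R-module to a quotient of H^d_b(M). -/

import Mathlib

/- Common definitions: local cohomology modules, cohomological dimension, module dimension,
secondary representations and attached primes. -/

open CategoryTheory TensorProduct

/-- The `i`-th local cohomology module `H^i_a(M)`, as a type with its `R`-module structure. -/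
noncomputable def TopLC (R : Type) [CommRing R] (a : Ideal R) (i : ℕ)
    (M : Type) [AddCommGroup M] [Module R M] : Type :=
  ((localCohomology a i).obj (ModuleCat.of R M))

noncomputable instance (R : Type) [CommRing R] (a : Ideal R) (i : ℕ)
    (M : Type) [AddCommGroup M] [Module R M] : AddCommGroup (TopLC R a i M) :=
  inferInstanceAs (AddCommGroup ((localCohomology a i).obj (ModuleCat.of R M)))

noncomputable instance (R : Type) [CommRing R] (a : Ideal R) (i : ℕ)
    (M : Type) [AddCommGroup M] [Module R M] : Module R (TopLC R a i M) :=
  inferInstanceAs (Module R ((localCohomology a i).obj (ModuleCat.of R M)))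

/-- The cohomological dimension `cd_R(a, M) = sup { i | H^i_a(M) ≠ 0 }`,
with value `⊥` if all local cohomology modules vanish. -/
noncomputable def cohDim (R : Type) [CommRing R] (a : Ideal R)
    (M : Type) [AddCommGroup M] [Module R M] : WithBot ℕ∞ :=
  sSup {n : WithBot ℕ∞ | ∃ i : ℕ, n = (i : ℕ) ∧ Nontrivial (TopLC R a i M)}

/-- The (Krull) dimension of a module, i.e. the Krull dimension of its support. -/
noncomputable def moduleDim (R : Type) [CommRing R]
    (M : Type) [AddCommGroup M] [Module R M] : WithBot ℕ∞ :=
  Order.krullDim (Module.support R M)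

/-- `Assh_R M`: the associated primes `p` of `M` with `dim R/p = dim M`. -/
noncomputable def Assh (R : Type) [CommRing R]
    (M : Type) [AddCommGroup M] [Module R M] : Set (Ideal R) :=
  { p | p ∈ associatedPrimes R M ∧ ringKrullDim (R ⧸ p) = moduleDim R M }

/-- A submodule `S` is secondary if `S ≠ 0` and every `r : R` acts on `S` either
surjectively or nilpotently. -/
def IsSecondarySub (R : Type) [CommRing R] {M : Type} [AddCommGroup M] [Module R M]
    (S : Submodule R M) : Prop :=
  S ≠ ⊥ ∧ ∀ r : R, (∀ m ∈ S, ∃ s ∈ S, r • s = m) ∨ (∃ n : ℕ, ∀ m ∈ S, r ^ n • m = 0)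

/-- A module is representable if it is the (finite) sum of secondary submodules. -/
def IsRepresentable (R : Type) [CommRing R] (M : Type) [AddCommGroup M] [Module R M] : Prop :=
  ∃ (n : ℕ) (S : Fin n → Submodule R M), (∀ i, IsSecondarySub R (S i)) ∧ (⨆ i, S i) = ⊤

/-- A minimal secondary representation: secondary submodules summing to the whole module,
with pairwise distinct attached primes, none contained in the sum of the others. -/
def IsMinimalRep (R : Type) [CommRing R] {M : Type} [AddCommGroup M] [Module R M]
    {n : ℕ} (S : Fin n → Submodule R M) : Prop :=
  (∀ i, IsSecondarySub R (S i)) ∧ (⨆ i, S i) = ⊤ ∧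
    (Function.Injective fun i => (S i).annihilator.radical) ∧
    ∀ j, ¬ (S j ≤ ⨆ i ∈ ({j}ᶜ : Set (Fin n)), S i)

/-- The attached primes of a module: the radicals of the annihilators of the terms of a
minimal secondary representation. -/
def AttachedPrimes (R : Type) [CommRing R] (M : Type) [AddCommGroup M] [Module R M] :
    Set (Ideal R) :=
  { p | ∃ (n : ℕ) (S : Fin n → Submodule R M), IsMinimalRep R S ∧
      ∃ i, p = (S i).annihilator.radical }

/-- `stab b N = ⟨b⟩N = ⋂ₙ bⁿN`. -/
def stab {R M : Type} [CommRing R] [AddCommGroup M] [Module R M]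
    (b : Ideal R) (N : Submodule R M) : Submodule R M :=
  ⨅ n : ℕ, b ^ n • N

section LocalCohomologyColimit
open Abelian

instance moduleCatHasExt (R : Type) [CommRing R] : HasExt.{0} (ModuleCat.{0} R) :=
  hasExt_of_enoughProjectives _

variable {R : Type} [CommRing R]

/-- The projection `R ⧸ J ⟶ R ⧸ I` for `J ≤ I`. -/
noncomputable def quotProj {I J : Ideal R} (h : J ≤ I) :
    ModuleCat.of R (R ⧸ J) ⟶ ModuleCat.of R (R ⧸ I) :=
  ModuleCat.ofHom (Submodule.factor h)

lemma quotProj_comp {I J K : Ideal R} (h : J ≤ I) (h' : K ≤ J) :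
    quotProj h' ≫ quotProj h = quotProj (h'.trans h) := by
  ext
  rfl

lemma quotProj_refl (I : Ideal R) : quotProj (le_refl I) = 𝟙 _ := by
  ext
  rfl

/-- The map `Ext^i(R ⧸ I, X) → Ext^i(R ⧸ J, X)` for `J ≤ I`. -/
noncomputable abbrev extProj {I J : Ideal R} (h : J ≤ I) (X : ModuleCat.{0} R) (i : ℕ) :
    Ext (ModuleCat.of R (R ⧸ I)) X i →ₗ[R] Ext (ModuleCat.of R (R ⧸ J)) X i :=
  Ext.precompOfLinear (Ext.mk₀ (quotProj h)) R X (zero_add i)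

lemma extProj_apply {I J : Ideal R} (h : J ≤ I) (X : ModuleCat.{0} R) (i : ℕ)
    (x : Ext (ModuleCat.of R (R ⧸ I)) X i) :
    extProj h X i x = (Ext.mk₀ (quotProj h)).comp x (zero_add i) := rfl

lemma extProj_extProj {I J K : Ideal R} (h : J ≤ I) (h' : K ≤ J) (X : ModuleCat.{0} R) (i : ℕ)
    (x : Ext (ModuleCat.of R (R ⧸ I)) X i) :
    extProj h' X i (extProj h X i x) = extProj (h'.trans h) X i x := by
  simp only [extProj_apply, Ext.mk₀_comp_mk₀_assoc, quotProj_comp]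

variable (a : Ideal R) (i : ℕ)

instance (X : ModuleCat.{0} R) :
    DirectedSystem (fun n => Ext (ModuleCat.of R (R ⧸ a ^ n)) X i)
      (fun _ _ h => ⇑(extProj (Ideal.pow_le_pow_right h) X i)) where
  map_self n x := by simp only [extProj_apply, quotProj_refl, Ext.mk₀_id_comp]
  map_map _ _ _ _ _ x := extProj_extProj _ _ _ _ _

/-- The colimit of the modules `Ext^i(R ⧸ a ^ n, N)`. -/
def LC (N : Type) [AddCommGroup N] [Module R N] : Type :=
  Module.DirectLimit (fun n => Ext (ModuleCat.of R (R ⧸ a ^ n)) (ModuleCat.of R N) i)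
    (fun _ _ h => extProj (Ideal.pow_le_pow_right h) (ModuleCat.of R N) i)

variable (N : Type) [AddCommGroup N] [Module R N]
  (N' : Type) [AddCommGroup N'] [Module R N'] (N'' : Type) [AddCommGroup N''] [Module R N'']

noncomputable instance : AddCommGroup (LC a i N) :=
  inferInstanceAs (AddCommGroup (Module.DirectLimit _ _))
noncomputable instance : Module R (LC a i N) :=
  inferInstanceAs (Module R (Module.DirectLimit _ _))

namespace LC

/-- The canonical map to the colimit. -/
noncomputable def of (n : ℕ) : Ext (ModuleCat.of R (R ⧸ a ^ n)) (ModuleCat.of R N) i →ₗ[R] LC a i N :=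
  Module.DirectLimit.of R ℕ (fun n => Ext (ModuleCat.of R (R ⧸ a ^ n)) (ModuleCat.of R N) i)
    (fun _ _ h => extProj (Ideal.pow_le_pow_right h) (ModuleCat.of R N) i) n

variable {a i N N' N''}

lemma exists_of (x : LC a i N) : ∃ n y, of a i N n y = x := Module.DirectLimit.exists_of x

lemma of_extProj {m n : ℕ} (h : m ≤ n) (y) :
    of a i N n (extProj (Ideal.pow_le_pow_right h) _ i y) = of a i N m y :=
  Module.DirectLimit.of_f (hij := h)

lemma of_eq_zero {n : ℕ} {y} (h : of a i N n y = 0) :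
    ∃ m, ∃ hm : n ≤ m, extProj (Ideal.pow_le_pow_right (I := a) hm) _ i y = 0 :=
  Module.DirectLimit.of.zero_exact h

/-- Linear maps out of the colimit. -/
noncomputable def lift {L : Type} [AddCommGroup L] [Module R L]
    (g : ∀ n, Ext (ModuleCat.of R (R ⧸ a ^ n)) (ModuleCat.of R N) i →ₗ[R] L)
    (hg : ∀ m n (h : m ≤ n) x, g n (extProj (Ideal.pow_le_pow_right h) _ i x) = g m x) :
    LC a i N →ₗ[R] L :=
  Module.DirectLimit.lift R ℕ _ _ g hg

@[simp] lemma lift_of {L : Type} [AddCommGroup L] [Module R L]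
    (g : ∀ n, Ext (ModuleCat.of R (R ⧸ a ^ n)) (ModuleCat.of R N) i →ₗ[R] L)
    (hg : ∀ m n (h : m ≤ n) x, g n (extProj (Ideal.pow_le_pow_right h) _ i x) = g m x) (n x) :
    lift g hg (of a i N n x) = g n x :=
  Module.DirectLimit.lift_of _ _ _

/-- Postcomposition with an extension class. -/
noncomputable def postcomp {i j k : ℕ} (h : i + j = k)
    (β : Ext (ModuleCat.of R N) (ModuleCat.of R N') j) : LC a i N →ₗ[R] LC a k N' :=
  lift (fun n => of a k N' n ∘ₗ Ext.postcompOfLinear β R _ h) (by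
    intro m n hmn x
    simp only [LinearMap.comp_apply]
    rw [← of_extProj hmn]
    congr 1
    exact Ext.comp_assoc _ _ _ (zero_add i) h (by omega))

@[simp] lemma postcomp_of {i j k : ℕ} (h : i + j = k)
    (β : Ext (ModuleCat.of R N) (ModuleCat.of R N') j) (n x) :
    postcomp (a := a) h β (of a i N n x) = of a k N' n (x.comp β h) := by
  simp [postcomp]

lemma postcomp_postcomp {i j k l m n : ℕ} (h : i + j = k) (h' : k + l = m) (h'' : j + l = n)
    (β : Ext (ModuleCat.of R N) (ModuleCat.of R N') j)
    (γ : Ext (ModuleCat.of R N') (ModuleCat.of R N'') l) (x : LC a i N) :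
    postcomp h' γ (postcomp h β x) = postcomp (by omega) (β.comp γ h'') x := by
  obtain ⟨n, x, rfl⟩ := exists_of x
  simp only [postcomp_of]
  rw [Ext.comp_assoc]
  omega

variable (a i) in
/-- Functoriality in the module. -/
noncomputable def map (f : N →ₗ[R] N') : LC a i N →ₗ[R] LC a i N' :=
  postcomp (add_zero i) (Ext.mk₀ (ModuleCat.ofHom f))

@[simp] lemma map_of (f : N →ₗ[R] N') (n x) :
    map a i f (of a i N n x) = of a i N' n (x.comp (Ext.mk₀ (ModuleCat.ofHom f)) (add_zero i)) :=
  postcomp_of _ _ _ _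

lemma map_comp (f : N →ₗ[R] N') (g : N' →ₗ[R] N'') (x) :
    map a i (g ∘ₗ f) x = map a i g (map a i f x) := by
  simp only [map]
  rw [postcomp_postcomp _ _ (zero_add 0), Ext.mk₀_comp_mk₀]
  rfl

lemma map_id (x) : map a i (LinearMap.id : N →ₗ[R] N) x = x := by
  obtain ⟨n, x, rfl⟩ := exists_of x
  rw [map_of]
  exact congrArg _ (Ext.comp_mk₀_id x)

lemma map_add (f g : N →ₗ[R] N') (x) : map a i (f + g) x = map a i f x + map a i g x := by
  obtain ⟨n, x, rfl⟩ := exists_of x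
  rw [map_of, map_of, map_of, ModuleCat.ofHom_add, Ext.mk₀_add, Ext.comp_add, _root_.map_add]

lemma map_smul (r : R) (f : N →ₗ[R] N') (x) : map a i (r • f) x = r • map a i f x := by
  obtain ⟨n, x, rfl⟩ := exists_of x
  rw [map_of, map_of, show ModuleCat.ofHom (r • f) = r • ModuleCat.ofHom f from rfl,
    Ext.mk₀_smul, Ext.comp_smul, _root_.map_smul]

/-- The short exact sequence in the category of modules. -/
lemma shortExact {f : N →ₗ[R] N'} {g : N' →ₗ[R] N''} (hf : Function.Injective f)
    (hg : Function.Surjective g) (h : Function.Exact f g) :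
    (ShortComplex.mk (ModuleCat.ofHom f) (ModuleCat.ofHom g)
      (by ext x; exact h.apply_apply_eq_zero x)).ShortExact where
  exact := (ShortComplex.ShortExact.moduleCat_exact_iff_function_exact _).2 h
  mono_f := (ModuleCat.mono_iff_injective _).2 hf
  epi_g := (ModuleCat.epi_iff_surjective _).2 hg

variable (a i) in
/-- The connecting homomorphism. -/
noncomputable def δ {f : N →ₗ[R] N'} {g : N' →ₗ[R] N''} (hf : Function.Injective f)
    (hg : Function.Surjective g) (h : Function.Exact f g) : LC a i N'' →ₗ[R] LC a (i + 1) N :=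
  postcomp rfl (shortExact hf hg h).extClass

section exact
variable {f : N →ₗ[R] N'} {g : N' →ₗ[R] N''} (hf : Function.Injective f)
    (hg : Function.Surjective g) (h : Function.Exact f g)

include hf hg h in
lemma exact_map : Function.Exact (map a i f) (map a i g) := by
  intro x
  constructor
  · intro hx
    obtain ⟨n, x, rfl⟩ := exists_of x
    rw [map_of] at hx
    obtain ⟨m, hm, hx⟩ := of_eq_zero hx
    rw [extProj_apply, ← Ext.comp_assoc (h₁₂ := zero_add i) (h := by omega)] at hx
    obtain ⟨y, hy⟩ := Ext.covariant_sequence_exact₂ _ (shortExact hf hg h) _ hx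
    refine ⟨of a i N m y, ?_⟩
    rw [map_of, ← of_extProj hm]
    exact congrArg _ hy
  · rintro ⟨y, rfl⟩
    rw [← map_comp, h.linearMap_comp_eq_zero]
    have := map_smul (a := a) (i := i) 0 (0 : N →ₗ[R] N'') y
    simpa using this

lemma exact_map_δ : Function.Exact (map a i g) (δ a i hf hg h) := by
  intro x
  constructor
  · intro hx
    obtain ⟨n, x, rfl⟩ := exists_of x
    rw [δ, postcomp_of] at hx
    obtain ⟨m, hm, hx⟩ := of_eq_zero hx
    rw [extProj_apply, ← Ext.comp_assoc (h₁₂ := zero_add i) (h := by omega)] at hx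
    obtain ⟨y, hy⟩ := Ext.covariant_sequence_exact₃ _ (shortExact hf hg h) _ rfl hx
    refine ⟨of a i N' m y, ?_⟩
    rw [map_of, ← of_extProj hm]
    exact congrArg _ hy
  · rintro ⟨y, rfl⟩
    obtain ⟨n, y, rfl⟩ := exists_of y
    rw [map_of, δ, postcomp_of, Ext.comp_assoc (h₂₃ := zero_add 1) (h := by omega)]
    erw [(shortExact hf hg h).comp_extClass, Ext.comp_zero]
    exact _root_.map_zero _

lemma exact_δ_map : Function.Exact (δ a i hf hg h) (map a (i + 1) f) := by
  intro x
  constructor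
  · intro hx
    obtain ⟨n, x, rfl⟩ := exists_of x
    rw [map_of] at hx
    obtain ⟨m, hm, hx⟩ := of_eq_zero hx
    rw [extProj_apply, ← Ext.comp_assoc (h₁₂ := zero_add _) (h := by omega)] at hx
    obtain ⟨y, hy⟩ := Ext.covariant_sequence_exact₁ _ (shortExact hf hg h) _ hx rfl
    refine ⟨of a i N'' m y, ?_⟩
    rw [δ, postcomp_of, ← of_extProj hm]
    exact congrArg _ hy
  · rintro ⟨y, rfl⟩
    obtain ⟨n, y, rfl⟩ := exists_of y
    rw [δ, postcomp_of, map_of, Ext.comp_assoc (h₂₃ := add_zero 1) (h := by omega)]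
    erw [(shortExact hf hg h).extClass_comp, Ext.comp_zero]
    exact _root_.map_zero _

lemma δ_naturality {L L' L'' : Type} [AddCommGroup L] [Module R L] [AddCommGroup L'] [Module R L']
    [AddCommGroup L''] [Module R L''] {f' : L →ₗ[R] L'} {g' : L' →ₗ[R] L''}
    (hf' : Function.Injective f') (hg' : Function.Surjective g') (h' : Function.Exact f' g')
    (u : N →ₗ[R] L) (v : N' →ₗ[R] L') (w : N'' →ₗ[R] L'') (huv : v ∘ₗ f = f' ∘ₗ u)
    (hvw : w ∘ₗ g = g' ∘ₗ v) (x : LC a i N'') :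
    map a (i + 1) u (δ a i hf hg h x) = δ a i hf' hg' h' (map a i w x) := by
  simp only [map, δ]
  rw [postcomp_postcomp _ _ (add_zero 1), postcomp_postcomp _ _ (zero_add 1)]
  congr 1
  have := ShortComplex.ShortExact.extClass_naturality (shortExact hf hg h) (shortExact hf' hg' h')
    { τ₁ := ModuleCat.ofHom u, τ₂ := ModuleCat.ofHom v, τ₃ := ModuleCat.ofHom w
      comm₁₂ := by
        ext x
        exact (LinearMap.congr_fun huv x).symm
      comm₂₃ := by
        ext x
        exact (LinearMap.congr_fun hvw x).symm }
  exact congrArg _ this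

end exact

lemma map_zero_injective {f : N →ₗ[R] N'} (hf : Function.Injective f) :
    Function.Injective (map a 0 f) := by
  rw [injective_iff_map_eq_zero]
  intro x hx
  obtain ⟨n, x, rfl⟩ := exists_of x
  rw [map_of] at hx
  obtain ⟨m, hm, hx⟩ := of_eq_zero hx
  rw [extProj_apply, ← Ext.comp_assoc (h₁₂ := zero_add _) (h := by omega)] at hx
  have := (ModuleCat.mono_iff_injective (ModuleCat.ofHom f)).2 hf
  have h2 := Ext.postcomp_mk₀_injective_of_mono (ModuleCat.of R (R ⧸ a ^ m)) (ModuleCat.ofHom f)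
  rw [← of_extProj hm, extProj_apply]
  have := h2 (a₁ := (Ext.mk₀ _).comp x _) (a₂ := 0) (by rw [_root_.map_zero]; exact hx)
  rw [this, _root_.map_zero]

/-- Every element of the colimit is killed by a power of the ideal. -/
lemma exists_pow_smul_eq_zero (x : LC a i N) : ∃ n, ∀ r ∈ a ^ n, r • x = 0 := by
  obtain ⟨n, x, rfl⟩ := exists_of x
  refine ⟨n, fun r hr => ?_⟩
  rw [← _root_.map_smul]
  have : (r • 𝟙 (ModuleCat.of R (R ⧸ a ^ n))) = 0 := by
    ext
    change r • (Submodule.Quotient.mk (1 : R) : R ⧸ a ^ n) = 0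
    rw [← Submodule.Quotient.mk_smul, Submodule.Quotient.mk_eq_zero]
    simpa using hr
  have h2 : r • x = (Ext.mk₀ (r • 𝟙 (ModuleCat.of R (R ⧸ a ^ n)))).comp x (zero_add i) := by
    rw [Ext.mk₀_smul, Ext.smul_comp, Ext.mk₀_id_comp]
  rw [h2, this, Ext.mk₀_zero, Ext.zero_comp, _root_.map_zero]

lemma exists_pow_smul_eq_zero_of_mem (x : LC a i N) {r : R} (hr : r ∈ a) :
    ∃ n, r ^ n • x = 0 := by
  obtain ⟨n, h⟩ := exists_pow_smul_eq_zero x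
  exact ⟨n, h _ (Ideal.pow_mem_pow hr n)⟩

variable {c : Ideal R}

variable (i N) in
/-- Comparison map for an inclusion of ideals. -/
noncomputable def res (hac : a ≤ c) : LC c i N →ₗ[R] LC a i N :=
  lift (fun n => of a i N n ∘ₗ extProj (Ideal.pow_right_mono hac n) _ i) (by
    intro m n hmn x
    simp only [LinearMap.comp_apply]
    rw [← of_extProj hmn, extProj_extProj, extProj_extProj])

lemma res_of (hac : a ≤ c) (n x) :
    res i N hac (of c i N n x) = of a i N n (extProj (Ideal.pow_right_mono hac n) _ i x) := by
  rw [res, lift_of]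
  rfl

lemma res_postcomp (hac : a ≤ c) {i j k : ℕ} (h : i + j = k)
    (β : Ext (ModuleCat.of R N) (ModuleCat.of R N') j) (x : LC c i N) :
    res k N' hac (postcomp h β x) = postcomp h β (res i N hac x) := by
  obtain ⟨n, x, rfl⟩ := exists_of x
  rw [postcomp_of, res_of, res_of, postcomp_of, extProj_apply, extProj_apply, Ext.comp_assoc]
  omega

lemma res_map (hac : a ≤ c) (f : N →ₗ[R] N') (x : LC c i N) :
    res i N' hac (map c i f x) = map a i f (res i N hac x) := res_postcomp _ _ _ _

lemma res_δ (hac : a ≤ c) {f : N →ₗ[R] N'} {g : N' →ₗ[R] N''} (hf : Function.Injective f)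
    (hg : Function.Surjective g) (h : Function.Exact f g) (x : LC c i N'') :
    res (i + 1) N hac (δ c i hf hg h x) = δ a i hf hg h (res i N'' hac x) := res_postcomp _ _ _ _

end LC
end LocalCohomologyColimit

section TorsionVanishing
open Abelian

variable {R : Type} [CommRing R]

/-- The submodule of elements killed by a power of `a`. -/
def powTorsion (a : Ideal R) (N : Type) [AddCommGroup N] [Module R N] : Submodule R N where
  carrier := {y | ∃ n : ℕ, ∀ r ∈ a ^ n, r • y = 0}
  zero_mem' := ⟨0, by simp⟩
  add_mem' := by
    rintro x y ⟨m, hm⟩ ⟨n, hn⟩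
    refine ⟨m + n, fun r hr => ?_⟩
    rw [smul_add, hm r (Ideal.pow_le_pow_right (by omega) hr),
      hn r (Ideal.pow_le_pow_right (by omega) hr), add_zero]
  smul_mem' := by
    rintro c x ⟨m, hm⟩
    exact ⟨m, fun r hr => by rw [smul_comm, hm r hr, smul_zero]⟩

variable {a : Ideal R} {N : Type} [AddCommGroup N] [Module R N]
  {N' : Type} [AddCommGroup N'] [Module R N']

namespace LC

variable (a N) in
/-- The degree zero part is the torsion submodule. -/
noncomputable def ev : LC a 0 N →ₗ[R] N :=
  lift (fun n => (LinearMap.applyₗ (Ideal.Quotient.mk (a ^ n) 1)) ∘ₗ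
      ModuleCat.homLinearEquiv.toLinearMap ∘ₗ (Ext.linearEquiv₀ (R := R)).toLinearMap) (by
    intro m n h x
    obtain ⟨x, rfl⟩ := (Ext.linearEquiv₀ (R := R)).symm.surjective x
    have : extProj (Ideal.pow_le_pow_right (I := a) h) _ 0 ((Ext.linearEquiv₀ (R := R)).symm x)
        = (Ext.linearEquiv₀ (R := R)).symm (quotProj (Ideal.pow_le_pow_right h) ≫ x) := by
      rw [extProj_apply, Ext.linearEquiv₀_symm_apply, Ext.linearEquiv₀_symm_apply,
        Ext.mk₀_comp_mk₀]
    rw [this]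
    simp only [LinearMap.comp_apply, LinearEquiv.coe_coe, LinearEquiv.apply_symm_apply]
    rfl)

lemma ev_of_mk₀ (n : ℕ) (f : R ⧸ a ^ n →ₗ[R] N) :
    ev a N (of a 0 N n (Ext.mk₀ (ModuleCat.ofHom f))) = f (Ideal.Quotient.mk _ 1) := by
  rw [ev, lift_of, ← Ext.linearEquiv₀_symm_apply (R := R)]
  simp only [LinearMap.comp_apply, LinearEquiv.coe_coe, LinearEquiv.apply_symm_apply]
  rfl

lemma exists_of_mk₀ (x : LC a 0 N) :
    ∃ (n : ℕ) (f : R ⧸ a ^ n →ₗ[R] N), of a 0 N n (Ext.mk₀ (ModuleCat.ofHom f)) = x := by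
  obtain ⟨n, x, rfl⟩ := exists_of x
  obtain ⟨x, rfl⟩ := (Ext.linearEquiv₀ (R := R)).symm.surjective x
  exact ⟨n, x.hom, rfl⟩

lemma ev_injective : Function.Injective (ev a N) := by
  rw [injective_iff_map_eq_zero]
  intro x hx
  obtain ⟨n, f, rfl⟩ := exists_of_mk₀ x
  rw [ev_of_mk₀] at hx
  have : f = 0 := by
    ext
    exact hx
  rw [this, ModuleCat.ofHom_zero, Ext.mk₀_zero, _root_.map_zero]

lemma exists_ev_eq {y : N} (hy : y ∈ powTorsion a N) : ∃ x, ev a N x = y := by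
  obtain ⟨n, hn⟩ := hy
  refine ⟨of a 0 N n (Ext.mk₀ (ModuleCat.ofHom
    ((a ^ n).liftQ (LinearMap.toSpanSingleton R N y) (fun r hr => ?_)))), ?_⟩
  · simpa using hn r hr
  · rw [ev_of_mk₀]
    exact (Submodule.liftQ_apply _ _ _).trans (by simp)

lemma ev_map (f : N →ₗ[R] N') (x : LC a 0 N) : ev a N' (map a 0 f x) = f (ev a N x) := by
  obtain ⟨n, g, rfl⟩ := exists_of_mk₀ x
  rw [map_of, Ext.mk₀_comp_mk₀, ev_of_mk₀, ← ModuleCat.ofHom_comp, ev_of_mk₀]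
  rfl

lemma ev_res {c : Ideal R} (hac : a ≤ c) (x : LC c 0 N) :
    ev a N (res 0 N hac x) = ev c N x := by
  obtain ⟨n, g, rfl⟩ := exists_of_mk₀ x
  rw [res_of, extProj_apply, Ext.mk₀_comp_mk₀, ev_of_mk₀, quotProj, ← ModuleCat.ofHom_comp,
    ev_of_mk₀]
  rfl

lemma subsingleton_of_injective (i : ℕ) [Module.Injective R N] :
    Subsingleton (LC a (i + 1) N) := by
  refine subsingleton_of_forall_eq 0 fun x => ?_
  obtain ⟨n, x, rfl⟩ := exists_of x
  have : Injective (ModuleCat.of R N) := Module.injective_object_of_injective_module R N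
  rw [Ext.eq_zero_of_injective x, map_zero]

end LC

lemma powTorsion_injective [IsNoetherianRing R] [Module.Injective R N] :
    Module.Injective R (powTorsion a N) := by
  apply Module.Baer.injective
  intro J f
  obtain ⟨n, hn⟩ : ∃ n : ℕ, ∀ r ∈ a ^ n, ∀ x : J, r • f x = 0 := by
    obtain ⟨s, hs⟩ := (isNoetherian_def.1 (inferInstance : IsNoetherian R J)) ⊤
    choose k hk using fun x : J => (f x).2
    refine ⟨s.sup k, fun r hr x => ?_⟩
    have hx : x ∈ Submodule.span R (s : Set J) := hs ▸ Submodule.mem_top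
    induction hx using Submodule.span_induction with
    | mem x hx =>
      exact Subtype.ext (hk x r (Ideal.pow_le_pow_right (Finset.le_sup hx) hr))
    | zero => simp
    | add x y _ _ h1 h2 => rw [map_add, smul_add, h1, h2, add_zero]
    | smul c x _ h => rw [map_smul, smul_comm, h, smul_zero]
  obtain ⟨k, hk⟩ := Ideal.exists_pow_inf_eq_pow_smul (M := R) a J
  have hk' : ∀ x ∈ J, x ∈ a ^ (n + k) → x ∈ a ^ n • J := by
    intro x hx hxa
    have : x ∈ a ^ (n + k) • (⊤ : Submodule R R) ⊓ J := ⟨by simpa using hxa, hx⟩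
    rw [hk (n + k) (by omega)] at this
    refine Submodule.smul_mono (Ideal.pow_le_pow_right (by omega)) inf_le_right this
  let φ : J →ₗ[R] (R ⧸ a ^ (n + k)) := (a ^ (n + k)).mkQ ∘ₗ J.subtype
  have hker : LinearMap.ker φ ≤ LinearMap.ker f := by
    intro x hx
    have hx' : (x : R) ∈ a ^ n • J := hk' x x.2 (Ideal.Quotient.eq_zero_iff_mem.1 hx)
    have key : ∃ h : (x : R) ∈ J, f ⟨x, h⟩ = 0 := by
      refine Submodule.smul_induction_on hx' (p := fun y => ∃ h : y ∈ J, f ⟨y, h⟩ = 0) ?_ ?_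
      · intro r hr z hz
        refine ⟨J.smul_mem r hz, ?_⟩
        have := hn r hr ⟨z, hz⟩
        rwa [← map_smul] at this
      · rintro y z ⟨hy, hy'⟩ ⟨hz, hz'⟩
        refine ⟨J.add_mem hy hz, ?_⟩
        have := congrArg₂ (· + ·) hy' hz'
        simp only [← map_add, add_zero] at this
        exact this
    exact key.2
  let ψ : LinearMap.range φ →ₗ[R] powTorsion a N :=
    (LinearMap.ker φ).liftQ f hker ∘ₗ φ.quotKerEquivRange.symm.toLinearMap
  obtain ⟨h, hh⟩ := Module.Injective.out (LinearMap.range φ).subtype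
    (Submodule.injective_subtype _) ((powTorsion a N).subtype ∘ₗ ψ)
  have hmem : ∀ x, h x ∈ powTorsion a N := by
    intro x
    refine ⟨n + k, fun r hr => ?_⟩
    rw [← map_smul]
    convert map_zero h
    obtain ⟨x, rfl⟩ := Ideal.Quotient.mk_surjective x
    change Ideal.Quotient.mk _ (r * x) = 0
    exact Ideal.Quotient.eq_zero_iff_mem.2 (Ideal.mul_mem_right _ _ hr)
  refine ⟨(h.codRestrict _ hmem) ∘ₗ (a ^ (n + k)).mkQ, fun x hx => ?_⟩
  apply Subtype.ext
  have := hh (φ.rangeRestrict ⟨x, hx⟩)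
  change h (φ ⟨x, hx⟩) = _
  refine this.trans ?_
  simp only [LinearMap.comp_apply, ψ]
  have : φ.quotKerEquivRange.symm (φ.rangeRestrict ⟨x, hx⟩) = Submodule.Quotient.mk ⟨x, hx⟩ := by
    rw [LinearEquiv.symm_apply_eq]
    rfl
  erw [this]
  exact congrArg Subtype.val (Submodule.liftQ_apply _ _ _)

lemma exists_injective_embedding (R : Type) [CommRing R] (N : Type) [AddCommGroup N] [Module R N] :
    ∃ (I : Type) (_ : AddCommGroup I) (_ : Module R I) (_ : Module.Injective R I)
      (f : N →ₗ[R] I), Function.Injective f := by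
  obtain ⟨⟨J, _, f, _⟩⟩ := EnoughInjectives.presentation (ModuleCat.of R N)
  refine ⟨J, inferInstance, inferInstance, ?_, f.hom, (ModuleCat.mono_iff_injective f).1 inferInstance⟩
  exact Module.injective_module_of_injective_object R J

lemma LC.subsingleton_of_torsion [IsNoetherianRing R] (hN : ∀ y : N, y ∈ powTorsion a N) (i : ℕ) :
    Subsingleton (LC a (i + 1) N) := by
  induction i generalizing N with
  | zero =>
    obtain ⟨I, _, _, _, f, hf⟩ := exists_injective_embedding R N
    have hfm : ∀ x, f x ∈ powTorsion a I := fun x => by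
      obtain ⟨n, hn⟩ := hN x
      exact ⟨n, fun r hr => by rw [← _root_.map_smul, hn r hr, _root_.map_zero]⟩
    let g : N →ₗ[R] powTorsion a I := f.codRestrict _ hfm
    have hg : Function.Injective g := fun x y h => hf (congrArg Subtype.val h)
    have hinj : Module.Injective R (powTorsion a I) := powTorsion_injective
    have hs := LC.subsingleton_of_injective (a := a) (N := powTorsion a I) 0
    have hex : Function.Exact g (LinearMap.range g).mkQ := LinearMap.exact_map_mkQ_range g
    have hsurj := Submodule.mkQ_surjective (LinearMap.range g)
    refine subsingleton_of_forall_eq 0 fun x => ?_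
    obtain ⟨z, rfl⟩ := (LC.exact_δ_map (a := a) (i := 0) hg hsurj hex x).1 (Subsingleton.elim _ _)
    obtain ⟨w, hw⟩ := hsurj (LC.ev a _ z)
    have hwt : w ∈ powTorsion a (powTorsion a I) := by
      obtain ⟨n, hn⟩ := w.2
      exact ⟨n, fun r hr => Subtype.ext (hn r hr)⟩
    obtain ⟨u, rfl⟩ := LC.exists_ev_eq hwt
    rw [← LC.ev_map] at hw
    rw [← LC.ev_injective hw]
    exact (LC.exact_map_δ hg hsurj hex _).2 ⟨u, rfl⟩
  | succ i ih =>
    obtain ⟨I, _, _, _, f, hf⟩ := exists_injective_embedding R N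
    have hfm : ∀ x, f x ∈ powTorsion a I := fun x => by
      obtain ⟨n, hn⟩ := hN x
      exact ⟨n, fun r hr => by rw [← _root_.map_smul, hn r hr, _root_.map_zero]⟩
    let g : N →ₗ[R] powTorsion a I := f.codRestrict _ hfm
    have hg : Function.Injective g := fun x y h => hf (congrArg Subtype.val h)
    have hinj : Module.Injective R (powTorsion a I) := powTorsion_injective
    have hs := LC.subsingleton_of_injective (a := a) (N := powTorsion a I) (i + 1)
    have hex : Function.Exact g (LinearMap.range g).mkQ := LinearMap.exact_map_mkQ_range g
    have hsurj := Submodule.mkQ_surjective (LinearMap.range g)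
    have := ih (N := powTorsion a I ⧸ LinearMap.range g) (fun y => by
      obtain ⟨y, rfl⟩ := hsurj y
      obtain ⟨n, hn⟩ := y.2
      refine ⟨n, fun r hr => ?_⟩
      rw [← _root_.map_smul, show r • y = 0 from Subtype.ext (hn r hr), _root_.map_zero])
    refine subsingleton_of_forall_eq 0 fun x => ?_
    obtain ⟨z, rfl⟩ := (LC.exact_δ_map (a := a) (i := i + 1) hg hsurj hex x).1
      (Subsingleton.elim _ _)
    rw [Subsingleton.elim z 0, _root_.map_zero]

end TorsionVanishing

section Comparison
open Abelian Limits HomologicalComplex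

variable {R : Type} [CommRing R]

namespace OldExt

variable (Y : ModuleCat.{0} R) (n : ℕ)

/-- The functor `Hom(-, Y)` with values in the opposite category. -/
noncomputable abbrev homFunctor : ModuleCat.{0} R ⥤ (ModuleCat.{0} R)ᵒᵖ :=
  ((linearYoneda R (ModuleCat.{0} R)).obj Y).rightOp

variable {X : ModuleCat.{0} R} (P : ProjectiveResolution X)

/-- The complex `Hom(P, Y)` as a chain complex in the opposite category. -/
noncomputable abbrev homComplex : ChainComplex (ModuleCat.{0} R)ᵒᵖ ℕ :=
  ((homFunctor Y).mapHomologicalComplex _).obj P.complex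

/-- The module of cocycles. -/
noncomputable abbrev cocyc : ModuleCat.{0} R := ((homComplex Y P).opcycles n).unop

/-- The inclusion of cocycles into cochains. -/
noncomputable abbrev inc : cocyc Y n P ⟶ ModuleCat.of R (P.complex.X n ⟶ Y) :=
  ((homComplex Y P).pOpcycles n).unop

/-- The cohomology class of a cocycle. -/
noncomputable abbrev cls : cocyc Y n P ⟶ ((homComplex Y P).homology n).unop :=
  ((homComplex Y P).homologyι n).unop

lemma inc_injective : Function.Injective (inc Y n P).hom :=
  (ModuleCat.mono_iff_injective _).1
    (unop_mono_of_epi ((homComplex Y P).pOpcycles n))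

lemma cls_surjective : Function.Surjective (cls Y n P).hom :=
  (ModuleCat.epi_iff_surjective _).1 inferInstance

lemma d_inc (m : ℕ) (w : cocyc Y n P) : P.complex.d m n ≫ (inc Y n P).hom w = 0 := by
  have h := (homComplex Y P).d_pOpcycles m n
  have h2 := congrArg (fun f => f.unop.hom w) h
  exact h2

lemma exists_inc (f : P.complex.X n ⟶ Y) (hf : P.complex.d (n + 1) n ≫ f = 0) :
    ∃ w, (inc Y n P).hom w = f := by
  let k : (homComplex Y P).X n ⟶ Opposite.op (ModuleCat.of R R) :=
    (ModuleCat.ofHom (LinearMap.toSpanSingleton R (P.complex.X n ⟶ Y) f)).op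
  have hk : (homComplex Y P).d (n + 1) n ≫ k = 0 := by
    apply Quiver.Hom.unop_inj
    ext
    change P.complex.d (n + 1) n ≫ ((1 : R) • f) = 0
    rw [one_smul, hf]
  refine ⟨((homComplex Y P).descOpcycles k (n + 1) (by simp) hk).unop.hom (1 : R), ?_⟩
  have h := (homComplex Y P).p_descOpcycles k (n + 1) (by simp) hk
  have h2 := congrArg (fun f => f.unop.hom (1 : R)) h
  refine h2.trans ?_
  exact one_smul R f

lemma cls_eq_zero_iff (w : cocyc Y n P) : (cls Y n P).hom w = 0 ↔
    ∃ g : P.complex.X ((ComplexShape.down ℕ).next n) ⟶ Y,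
      P.complex.d n ((ComplexShape.down ℕ).next n) ≫ g = (inc Y n P).hom w := by
  let K := homComplex Y P
  have hS : (ShortComplex.mk (K.homologyι n) (K.fromOpcycles n _)
      (K.homologyι_comp_fromOpcycles n _)).Exact :=
    ShortComplex.exact_of_f_is_kernel _ (K.homologyIsKernel n _ rfl)
  have hS' := (ShortComplex.moduleCat_exact_iff _).1 hS.unop
  constructor
  · intro hw
    obtain ⟨g, hg⟩ := hS' w hw
    refine ⟨g, ?_⟩
    rw [← hg]
    have h := K.p_fromOpcycles n ((ComplexShape.down ℕ).next n)
    exact (congrArg (fun f => f.unop.hom g) h).symm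
  · rintro ⟨g, hg⟩
    have h := K.p_fromOpcycles n ((ComplexShape.down ℕ).next n)
    have h1 : w = (K.fromOpcycles n ((ComplexShape.down ℕ).next n)).unop.hom g := by
      apply inc_injective
      rw [← hg]
      exact (congrArg (fun f => f.unop.hom g) h).symm
    rw [h1]
    have h2 := K.homologyι_comp_fromOpcycles n ((ComplexShape.down ℕ).next n)
    exact congrArg (fun f => f.unop.hom g) h2

lemma smul_extMk {n : ℕ} (r : R) (f : P.complex.X n ⟶ Y) (m : ℕ) (hm : n + 1 = m)
    (hf : P.complex.d m n ≫ f = 0) :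
    r • P.extMk f m hm hf = P.extMk (r • f) m hm (by simp [hf]) := by
  rw [Ext.smul_eq_comp_mk₀, P.extMk_comp_mk₀]
  congr 1

/-- The map from cocycles to extension classes. -/
noncomputable def toExt : cocyc Y n P →ₗ[R] Ext X Y n where
  toFun w := P.extMk ((inc Y n P).hom w) (n + 1) rfl (d_inc Y n P _ w)
  map_add' w w' := by
    rw [P.add_extMk]
    congr 1
    exact map_add _ _ _
  map_smul' r w := by
    rw [RingHom.id_apply, smul_extMk]
    congr 1
    exact map_smul _ _ _

lemma toExt_surjective : Function.Surjective (toExt Y n P) := by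
  intro α
  obtain ⟨f, hf, rfl⟩ := P.extMk_surjective α (n + 1) rfl
  obtain ⟨w, rfl⟩ := exists_inc Y n P f hf
  exact ⟨w, rfl⟩

lemma extMk_zero_eq_zero (f : P.complex.X 0 ⟶ Y) (hf : P.complex.d 1 0 ≫ f = 0)
    (h : P.extMk f 1 rfl hf = 0) : f = 0 := by
  rw [← P.extEquivCohomologyClass.apply_eq_iff_eq,
    ProjectiveResolution.extEquivCohomologyClass_extMk,
    ProjectiveResolution.extEquivCohomologyClass_zero,
    CochainComplex.HomComplex.CohomologyClass.mk_eq_zero_iff,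
    CochainComplex.HomComplex.Cocycle.toSingleMk_mem_coboundaries_iff _ _ _ _ _ 1 (by lia)] at h
  obtain ⟨g, hg⟩ := h
  have : IsZero (P.cochainComplex.X 1) := by
    exact P.cochainComplex.isZero_of_isStrictlyLE 0 1 (by lia)
  rw [this.eq_of_src g 0, comp_zero] at hg
  rwa [← cancel_epi (P.cochainComplexXIso (-((0 : ℕ) : ℤ)) 0 rfl).hom, comp_zero, eq_comm]

lemma toExt_eq_zero_iff (w : cocyc Y n P) : toExt Y n P w = 0 ↔ (cls Y n P).hom w = 0 := by
  rw [cls_eq_zero_iff]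
  cases n with
  | zero =>
    constructor
    · intro h
      refine ⟨0, ?_⟩
      rw [comp_zero]
      exact (extMk_zero_eq_zero Y P _ (d_inc Y 0 P 1 w) h).symm
    · rintro ⟨g, hg⟩
      have : P.complex.d 0 ((ComplexShape.down ℕ).next 0) = 0 := P.complex.shape _ _ (by simp)
      rw [this, zero_comp] at hg
      rw [show w = 0 from inc_injective Y 0 P (by rw [← hg, map_zero]), map_zero]
  | succ p =>
    have hp : (ComplexShape.down ℕ).next (p + 1) = p := ChainComplex.next_nat_succ p
    rw [hp]
    exact P.extMk_eq_zero_iff _ (p + 1 + 1) rfl (d_inc Y (p + 1) P _ w) p rfl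

/-- The two definitions of extension modules agree on a projective resolution. -/
noncomputable def homologyEquiv : ((homComplex Y P).homology n).unop ≃ₗ[R] Ext X Y n :=
  ((cls Y n P).hom.quotKerEquivOfSurjective (cls_surjective Y n P)).symm ≪≫ₗ
    Submodule.quotEquivOfEq _ _ (by
      ext w
      rw [LinearMap.mem_ker, LinearMap.mem_ker, toExt_eq_zero_iff]) ≪≫ₗ
    (toExt Y n P).quotKerEquivOfSurjective (toExt_surjective Y n P)

lemma homologyEquiv_cls (w : cocyc Y n P) :
    homologyEquiv Y n P ((cls Y n P).hom w) = toExt Y n P w := by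
  have h : ((cls Y n P).hom.quotKerEquivOfSurjective (cls_surjective Y n P)).symm
      ((cls Y n P).hom w) = Submodule.Quotient.mk w :=
    (LinearEquiv.symm_apply_eq _).2 rfl
  simp only [homologyEquiv, LinearEquiv.trans_apply, h]
  rfl

/-- The comparison between the two definitions of extension modules. -/
noncomputable def equiv (X : ModuleCat.{0} R) :
    ((_root_.Ext R (ModuleCat.{0} R) n).obj (Opposite.op X)).obj Y ≃ₗ[R] Abelian.Ext X Y n :=
  ((projectiveResolution X).isoLeftDerivedObj (homFunctor Y) n).unop.toLinearEquiv.symm ≪≫ₗ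
    homologyEquiv Y n (projectiveResolution X)

lemma equiv_symm_cls (w : cocyc Y n (projectiveResolution X)) :
    equiv Y n X (((projectiveResolution X).isoLeftDerivedObj (homFunctor Y) n).hom.unop.hom
      ((cls Y n _).hom w)) = toExt Y n _ w := by
  rw [← homologyEquiv_cls]
  exact congrArg (homologyEquiv Y n (projectiveResolution X))
    (((projectiveResolution X).isoLeftDerivedObj
      (homFunctor Y) n).unop.toLinearEquiv.symm_apply_apply _)

lemma exists_cls (x : ((_root_.Ext R (ModuleCat.{0} R) n).obj (Opposite.op X)).obj Y) :
    ∃ w, ((projectiveResolution X).isoLeftDerivedObj (homFunctor Y) n).hom.unop.hom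
      ((cls Y n _).hom w) = x := by
  obtain ⟨z, hz⟩ := ((projectiveResolution X).isoLeftDerivedObj
    (homFunctor Y) n).unop.toLinearEquiv.surjective x
  obtain ⟨w, rfl⟩ := cls_surjective Y n _ z
  exact ⟨w, hz⟩

/-- A lift of a morphism to the chosen projective resolutions. -/
noncomputable def resolutionHom {X' X : ModuleCat.{0} R} (g : X' ⟶ X) :
    ProjectiveResolution.Hom (projectiveResolution X') (projectiveResolution X) g where
  hom := ProjectiveResolution.lift g _ _
  hom_f_zero_comp_π_f_zero := by
    have h := ProjectiveResolution.lift_commutes g (projectiveResolution X')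
      (projectiveResolution X)
    exact congrArg (fun f => f.f 0) h

lemma equiv_naturality {X' X : ModuleCat.{0} R} (g : X' ⟶ X)
    (x : ((_root_.Ext R (ModuleCat.{0} R) n).obj (Opposite.op X)).obj Y) :
    equiv Y n X' ((((_root_.Ext R (ModuleCat.{0} R) n).map g.op).app Y).hom x) =
      (Ext.mk₀ g).comp (equiv Y n X x) (zero_add n) := by
  obtain ⟨w, rfl⟩ := exists_cls Y n x
  let φ := resolutionHom g
  let ψ := ((homFunctor Y).mapHomologicalComplex (ComplexShape.down ℕ)).map φ.hom
  have h1 := congrArg (fun f => f.unop.hom ((cls Y n _).hom w))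
    (ProjectiveResolution.isoLeftDerivedObj_hom_naturality g (projectiveResolution X')
      (projectiveResolution X) φ.hom (φ.hom_f_zero_comp_π_f_zero.trans
        (congrArg _ (ChainComplex.single₀_map_f_zero g))) (homFunctor Y) n)
  have h2 := congrArg (fun f => f.unop.hom w) (HomologicalComplex.homologyι_naturality ψ n)
  have h3 := congrArg (fun f => f.unop.hom w) (HomologicalComplex.p_opcyclesMap ψ n)
  rw [equiv_symm_cls]
  refine (congrArg (equiv Y n X') h1).trans ?_
  refine (congrArg (equiv Y n X') (congrArg (((projectiveResolution X').isoLeftDerivedObj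
    (homFunctor Y) n).hom.unop.hom) h2)).trans ?_
  refine (equiv_symm_cls Y n _).trans ?_
  refine Eq.trans ?_ (ProjectiveResolution.mk₀_comp_extMk _ (n + 1) rfl (d_inc Y n _ _ w) φ).symm
  dsimp only [toExt, LinearMap.coe_mk, AddHom.coe_mk]
  congr 1

end OldExt
end Comparison

section ComparisonColimit
open Limits Opposite

variable {R : Type} [CommRing R] (a : Ideal R) (i : ℕ) (M : Type) [AddCommGroup M] [Module R M]

/-- The diagram whose colimit computes local cohomology. -/
noncomputable abbrev lcDiagram : (ℕᵒᵖ)ᵒᵖ ⥤ ModuleCat.{0} R :=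
  localCohomology.diagram (localCohomology.idealPowersDiagram a) i ⋙
    (evaluation _ _).obj (ModuleCat.of R M)

/-- The cocone exhibiting local cohomology as a colimit of modules. -/
noncomputable abbrev lcCocone : Cocone (lcDiagram a i M) :=
  ((evaluation _ _).obj (ModuleCat.of R M)).mapCocone
    (colimit.cocone (localCohomology.diagram (localCohomology.idealPowersDiagram a) i))

/-- The local cohomology cocone is a colimit. -/
noncomputable def lcCoconeIsColimit : IsColimit (lcCocone a i M) :=
  isColimitOfPreserves _ (colimit.isColimit _)

lemma lcDiagram_equiv {m n : ℕ} (h : m ≤ n) (x : (lcDiagram a i M).obj (op (op m))) :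
    OldExt.equiv (ModuleCat.of R M) i (ModuleCat.of R (R ⧸ a ^ n))
      (((lcDiagram a i M).map (homOfLE h).op.op).hom x) =
    extProj (Ideal.pow_le_pow_right h) _ i
      (OldExt.equiv (ModuleCat.of R M) i (ModuleCat.of R (R ⧸ a ^ m)) x) :=
  OldExt.equiv_naturality (ModuleCat.of R M) i (quotProj (Ideal.pow_le_pow_right h)) x

/-- The comparison cocone. -/
noncomputable def lcCompareCocone : Cocone (lcDiagram a i M) where
  pt := ModuleCat.of R (LC a i M)
  ι :=
    { app := fun n => ModuleCat.ofHom (LC.of a i M n.unop.unop ∘ₗ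
        (OldExt.equiv (ModuleCat.of R M) i
          (ModuleCat.of R (R ⧸ a ^ n.unop.unop))).toLinearMap)
      naturality := fun m n f => by
        ext x
        change LC.of a i M _ (OldExt.equiv _ _ _ (((lcDiagram a i M).map f).hom x)) =
          LC.of a i M _ (OldExt.equiv _ _ _ x)
        have h : m.unop.unop ≤ n.unop.unop := f.unop.unop.down.down
        rw [← LC.of_extProj h]
        exact congrArg _ (lcDiagram_equiv a i M h x) }

/-- The maps from extension modules to local cohomology. -/
noncomputable def ofExt (n : ℕ) :
    Abelian.Ext (ModuleCat.of R (R ⧸ a ^ n)) (ModuleCat.of R M) i →ₗ[R] (lcCocone a i M).pt :=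
  ((lcCocone a i M).ι.app (op (op n))).hom ∘ₗ
    (OldExt.equiv (ModuleCat.of R M) i (ModuleCat.of R (R ⧸ a ^ n))).symm.toLinearMap

lemma ofExt_equiv (n : ℕ) (x) : ofExt a i M n (OldExt.equiv (ModuleCat.of R M) i
    (ModuleCat.of R (R ⧸ a ^ n)) x) = ((lcCocone a i M).ι.app (op (op n))).hom x :=
  congrArg ((lcCocone a i M).ι.app (op (op n))).hom (LinearEquiv.symm_apply_apply _ x)

/-- The map from the concrete colimit to local cohomology. -/
noncomputable def ofLC : LC a i M →ₗ[R] (lcCocone a i M).pt :=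
  LC.lift (ofExt a i M) (by
    intro m n h x
    obtain ⟨x, rfl⟩ := (OldExt.equiv (ModuleCat.of R M) i (ModuleCat.of R (R ⧸ a ^ m))).surjective x
    refine (congrArg _ (lcDiagram_equiv a i M h x).symm).trans ((ofExt_equiv _ _ _ _ _).trans ?_)
    refine Eq.trans ?_ (ofExt_equiv _ _ _ _ _).symm
    exact congrArg (fun f => f.hom x) ((lcCocone a i M).w (homOfLE h).op.op))

/-- The map from local cohomology to the concrete colimit. -/
noncomputable def toLC : (lcCocone a i M).pt →ₗ[R] LC a i M :=
  ((lcCoconeIsColimit a i M).desc (lcCompareCocone a i M)).hom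

lemma toLC_ι (n : ℕ) (x) : toLC a i M (((lcCocone a i M).ι.app (op (op n))).hom x) =
    LC.of a i M n (OldExt.equiv (ModuleCat.of R M) i (ModuleCat.of R (R ⧸ a ^ n)) x) :=
  congrArg (fun f => f.hom x) ((lcCoconeIsColimit a i M).fac (lcCompareCocone a i M) (op (op n)))

lemma toLC_ofLC (x) : toLC a i M (ofLC a i M x) = x := by
  obtain ⟨n, x, rfl⟩ := LC.exists_of x
  obtain ⟨x, rfl⟩ := (OldExt.equiv (ModuleCat.of R M) i (ModuleCat.of R (R ⧸ a ^ n))).surjective x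
  rw [ofLC, LC.lift_of, ofExt_equiv]
  exact toLC_ι a i M n x

lemma ofLC_toLC (x) : ofLC a i M (toLC a i M x) = x := by
  have h : ModuleCat.ofHom (ofLC a i M ∘ₗ toLC a i M) = 𝟙 (lcCocone a i M).pt := by
    refine (lcCoconeIsColimit a i M).hom_ext fun n => ?_
    ext x
    change ofLC a i M (toLC a i M (((lcCocone a i M).ι.app n).hom x)) =
      ((lcCocone a i M).ι.app n).hom x
    exact (congrArg _ (toLC_ι a i M n.unop.unop x)).trans
      ((LC.lift_of _ _ _ _).trans (ofExt_equiv _ _ _ _ _))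
  exact congrArg (fun f => f.hom x) h

/-- Local cohomology is the concrete colimit of extension modules. -/
noncomputable def localCohomologyEquiv :
    ((localCohomology a i).obj (ModuleCat.of R M)) ≃ₗ[R] LC a i M :=
  LinearEquiv.ofLinearMap (toLC a i M) (ofLC a i M) (LinearMap.ext (toLC_ofLC a i M))
    (LinearMap.ext (ofLC_toLC a i M))
end ComparisonColimit

section CohomologicalFunctor

/-- A cohomological functor on modules: functors in each degree with connecting homomorphisms
giving long exact sequences. -/
structure DeltaFun (A : Type) [CommRing A] where
  /-- The value in a given degree. -/
  obj : ℕ → ∀ (N : Type) [AddCommGroup N] [Module A N], Type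
  acg : ∀ (i : ℕ) (N : Type) [AddCommGroup N] [Module A N], AddCommGroup (obj i N)
  mod : ∀ (i : ℕ) (N : Type) [AddCommGroup N] [Module A N], Module A (obj i N)
  /-- Functoriality. -/
  map : ∀ (i : ℕ) {N N' : Type} [AddCommGroup N] [Module A N] [AddCommGroup N'] [Module A N'],
    (N →ₗ[A] N') → obj i N →ₗ[A] obj i N'
  map_smul_id : ∀ (i : ℕ) (N : Type) [AddCommGroup N] [Module A N] (r : A) (x : obj i N),
    map i (r • LinearMap.id : N →ₗ[A] N) x = r • x
  map_comp : ∀ (i : ℕ) {N N' N'' : Type} [AddCommGroup N] [Module A N] [AddCommGroup N']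
    [Module A N'] [AddCommGroup N''] [Module A N''] (f : N →ₗ[A] N') (g : N' →ₗ[A] N'')
    (x : obj i N), map i (g ∘ₗ f) x = map i g (map i f x)
  /-- The connecting homomorphism. -/
  δ : ∀ (i : ℕ) {N N' N'' : Type} [AddCommGroup N] [Module A N] [AddCommGroup N']
    [Module A N'] [AddCommGroup N''] [Module A N''] {f : N →ₗ[A] N'} {g : N' →ₗ[A] N''},
    Function.Injective f → Function.Surjective g → Function.Exact f g →
    obj i N'' →ₗ[A] obj (i + 1) N
  map_zero_injective : ∀ {N N' : Type} [AddCommGroup N] [Module A N] [AddCommGroup N']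
    [Module A N'] {f : N →ₗ[A] N'}, Function.Injective f → Function.Injective (map 0 f)
  exact_map : ∀ (i : ℕ) {N N' N'' : Type} [AddCommGroup N] [Module A N] [AddCommGroup N']
    [Module A N'] [AddCommGroup N''] [Module A N''] {f : N →ₗ[A] N'} {g : N' →ₗ[A] N''},
    Function.Injective f → Function.Surjective g → Function.Exact f g →
    Function.Exact (map i f) (map i g)
  exact_map_δ : ∀ (i : ℕ) {N N' N'' : Type} [AddCommGroup N] [Module A N] [AddCommGroup N']
    [Module A N'] [AddCommGroup N''] [Module A N''] {f : N →ₗ[A] N'} {g : N' →ₗ[A] N''}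
    (hf : Function.Injective f) (hg : Function.Surjective g) (h : Function.Exact f g),
    Function.Exact (map i g) (δ i hf hg h)
  exact_δ_map : ∀ (i : ℕ) {N N' N'' : Type} [AddCommGroup N] [Module A N] [AddCommGroup N']
    [Module A N'] [AddCommGroup N''] [Module A N''] {f : N →ₗ[A] N'} {g : N' →ₗ[A] N''}
    (hf : Function.Injective f) (hg : Function.Surjective g) (h : Function.Exact f g),
    Function.Exact (δ i hf hg h) (map (i + 1) f)

attribute [instance] DeltaFun.acg DeltaFun.mod

variable {A : Type} [CommRing A]

theorem fg_induction [IsNoetherianRing A]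
    {P : ∀ (N : Type) [AddCommGroup N] [Module A N], Prop}
    (zero : ∀ (N : Type) [AddCommGroup N] [Module A N] [Subsingleton N], P N)
    (exact : ∀ (N₁ N₂ N₃ : Type) [AddCommGroup N₁] [Module A N₁] [AddCommGroup N₂] [Module A N₂]
      [AddCommGroup N₃] [Module A N₃] [Module.Finite A N₁] [Module.Finite A N₂]
      [Module.Finite A N₃]
      (f : N₁ →ₗ[A] N₂) (g : N₂ →ₗ[A] N₃), Function.Injective f → Function.Surjective g →
      Function.Exact f g → P N₁ → P N₃ → P N₂)
    (prime : ∀ q : PrimeSpectrum A,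
      (∀ y ∉ q.asIdeal, P (A ⧸ (q.asIdeal ⊔ Ideal.span {y}))) → P (A ⧸ q.asIdeal))
    (N : Type) [AddCommGroup N] [Module A N] [Module.Finite A N] : P N := by
  have equiv (N₁ N₂ : Type) [AddCommGroup N₁] [Module A N₁] [Module.Finite A N₁]
      [AddCommGroup N₂] [Module A N₂] [Module.Finite A N₂]
      (f : N₁ ≃ₗ[A] N₂) (h : P N₁) : P N₂ :=
    exact N₁ N₂ PUnit f.toLinearMap 0 f.injective (Function.surjective_to_subsingleton _)
      ((LinearMap.exact_zero_iff_surjective _ _).2 f.surjective) h (zero _)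
  suffices H : ∀ (I : Ideal A) (N : Type) [AddCommGroup N] [Module A N] [Module.Finite A N],
      I ≤ Module.annihilator A N → P N from H ⊥ N bot_le
  intro I
  induction I using WellFoundedGT.induction with
  | ind I ih =>
    intro N _ _ hN
    induction hN using IsNoetherianRing.induction_on_isQuotientEquivQuotientPrime A with
    | subsingleton N => exact fun _ => zero N
    | quotient N p e =>
      intro hI
      refine equiv _ _ e.symm (prime p fun y hy => ?_)
      have hIp : I ≤ p.asIdeal := by
        rw [e.annihilator_eq, Ideal.annihilator_quotient] at hI
        exact hI
      refine ih (p.asIdeal ⊔ Ideal.span {y}) (lt_of_le_of_ne (hIp.trans le_sup_left) ?_) _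
        (by rw [Ideal.annihilator_quotient])
      rintro rfl
      exact hy (hIp (Ideal.mem_sup_right (Ideal.mem_span_singleton_self y)))
    | exact N₁ N₂ N₃ f g hf hg h h₁ h₃ =>
      intro hI
      exact exact N₁ N₂ N₃ f g hf hg h (h₁ (hI.trans (f.annihilator_le_of_injective hf)))
        (h₃ (hI.trans (g.annihilator_le_of_surjective hg)))

section smul_sequence
variable (q : Ideal A) (y : A)

/-- The projection `A ⧸ q → A ⧸ (q + y)`. -/
abbrev quotSup : (A ⧸ q) →ₗ[A] A ⧸ (q ⊔ Ideal.span {y}) := Submodule.factor le_sup_left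

lemma quotSup_surjective : Function.Surjective (quotSup q y) :=
  Submodule.factor_surjective _

variable {q y}

lemma smul_id_injective [hq : q.IsPrime] (hy : y ∉ q) :
    Function.Injective (y • LinearMap.id : (A ⧸ q) →ₗ[A] (A ⧸ q)) := by
  rw [injective_iff_map_eq_zero]
  intro x hx
  obtain ⟨x, rfl⟩ := Ideal.Quotient.mk_surjective x
  change Ideal.Quotient.mk q (y * x) = 0 at hx
  rw [Ideal.Quotient.eq_zero_iff_mem] at hx ⊢
  exact (hq.mem_or_mem hx).resolve_left hy

lemma smul_id_exact :
    Function.Exact (y • LinearMap.id : (A ⧸ q) →ₗ[A] (A ⧸ q)) (quotSup q y) := by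
  intro x
  obtain ⟨x, rfl⟩ := Ideal.Quotient.mk_surjective x
  change Ideal.Quotient.mk _ x = 0 ↔ _
  rw [Ideal.Quotient.eq_zero_iff_mem, Submodule.mem_sup]
  constructor
  · rintro ⟨u, hu, v, hv, rfl⟩
    obtain ⟨c, rfl⟩ := Ideal.mem_span_singleton'.1 hv
    refine ⟨Ideal.Quotient.mk _ c, ?_⟩
    change Ideal.Quotient.mk q (y * c) = _
    rw [Ideal.Quotient.eq, show y * c - (u + c * y) = -u by ring]
    exact q.neg_mem hu
  · rintro ⟨c, hc⟩
    obtain ⟨c, rfl⟩ := Ideal.Quotient.mk_surjective c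
    change Ideal.Quotient.mk q (y * c) = _ at hc
    rw [Ideal.Quotient.eq] at hc
    exact ⟨x - y * c, by rw [← neg_sub]; exact q.neg_mem hc, y * c,
      Ideal.mem_span_singleton.2 (dvd_mul_right _ _), by ring⟩

end smul_sequence

namespace DeltaFun

variable (G : DeltaFun A)

section basic
variable {N N' : Type} [AddCommGroup N] [Module A N] [AddCommGroup N'] [Module A N']

lemma map_id (i : ℕ) (x : G.obj i N) : G.map i (LinearMap.id : N →ₗ[A] N) x = x := by
  rw [← one_smul A LinearMap.id, map_smul_id, one_smul]

lemma subsingleton_obj [Subsingleton N] (i : ℕ) : Subsingleton (G.obj i N) := by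
  refine subsingleton_of_forall_eq 0 fun x => ?_
  rw [← G.map_id i x, ← zero_smul A x, ← G.map_smul_id]
  exact congrArg (G.map i · x) (LinearMap.ext fun _ => Subsingleton.elim _ _)


/-- Every value is torsion with respect to each element of `J`. -/
def Torsion (J : Ideal A) : Prop :=
  ∀ (i : ℕ) (N : Type) [AddCommGroup N] [Module A N] (x : G.obj i N), ∀ y ∈ J,
    ∃ n : ℕ, y ^ n • x = 0

/-- The functors vanish in positive degree on modules killed by `J`. -/
def Vanish (J : Ideal A) : Prop :=
  ∀ (i : ℕ) (N : Type) [AddCommGroup N] [Module A N], J ≤ Module.annihilator A N →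
    Subsingleton (G.obj (i + 1) N)

end basic

section prime
variable {q : Ideal A} [q.IsPrime] {y : A} (hy : y ∉ q)

include hy in
lemma exact_smul_map (i : ℕ) : Function.Exact (fun x : G.obj i (A ⧸ q) => y • x)
    (G.map i (quotSup q y)) := by
  have h := G.exact_map i (smul_id_injective hy) (quotSup_surjective q y) smul_id_exact
  intro x
  rw [h x]
  simp only [Set.mem_range, map_smul_id]

/-- The connecting map for multiplication by `y` on `A ⧸ q`. -/
noncomputable abbrev δq (i : ℕ) :
    G.obj i (A ⧸ (q ⊔ Ideal.span {y})) →ₗ[A] G.obj (i + 1) (A ⧸ q) :=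
  G.δ i (smul_id_injective hy) (quotSup_surjective q y) smul_id_exact

lemma exact_map_δq (i : ℕ) : Function.Exact (G.map i (quotSup q y)) (G.δq hy i) :=
  G.exact_map_δ i (smul_id_injective hy) (quotSup_surjective q y) smul_id_exact

lemma exact_δq_smul (i : ℕ) : Function.Exact (G.δq hy i)
    (fun x : G.obj (i + 1) (A ⧸ q) => y • x) := by
  have h := G.exact_δ_map i (smul_id_injective hy) (quotSup_surjective q y) smul_id_exact
  intro x
  rw [← h x, map_smul_id]

include hy in
lemma smul_injective_zero : Function.Injective (fun x : G.obj 0 (A ⧸ q) => y • x) := by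
  have h := G.map_zero_injective (smul_id_injective hy)
  intro x x' hx
  apply h
  simpa only [map_smul_id] using hx

end prime

end DeltaFun

lemma eq_zero_of_pow_smul_eq_zero {X : Type*} [AddCommGroup X] [Module A X] {y : A}
    (h : ∀ x : X, y • x = 0 → x = 0) {n : ℕ} {x : X} (hx : y ^ n • x = 0) : x = 0 := by
  induction n with
  | zero => simpa using hx
  | succ n ih => exact ih (h _ (by rwa [smul_smul, ← pow_succ']))

end CohomologicalFunctor

section DeltaHom
variable {A : Type} [CommRing A]

/-- A morphism of cohomological functors. -/
structure DeltaHom (F G : DeltaFun A) where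
  /-- The components. -/
  app : ∀ (i : ℕ) (N : Type) [AddCommGroup N] [Module A N], F.obj i N →ₗ[A] G.obj i N
  map : ∀ (i : ℕ) {N N' : Type} [AddCommGroup N] [Module A N] [AddCommGroup N'] [Module A N']
    (f : N →ₗ[A] N') (x : F.obj i N), app i N' (F.map i f x) = G.map i f (app i N x)
  δ : ∀ (i : ℕ) {N N' N'' : Type} [AddCommGroup N] [Module A N] [AddCommGroup N']
    [Module A N'] [AddCommGroup N''] [Module A N''] {f : N →ₗ[A] N'} {g : N' →ₗ[A] N''}
    (hf : Function.Injective f) (hg : Function.Surjective g) (h : Function.Exact f g)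
    (x : F.obj i N''), app (i + 1) N (F.δ i hf hg h x) = G.δ i hf hg h (app i N'' x)

namespace DeltaHom
variable {F G : DeltaFun A} (φ : DeltaHom F G)

lemma bijective_of_exact {N₁ N₂ N₃ : Type} [AddCommGroup N₁] [Module A N₁] [AddCommGroup N₂]
    [Module A N₂] [AddCommGroup N₃] [Module A N₃] {f : N₁ →ₗ[A] N₂} {g : N₂ →ₗ[A] N₃}
    (hf : Function.Injective f) (hg : Function.Surjective g) (h : Function.Exact f g)
    (h₁ : ∀ i, Function.Bijective (φ.app i N₁)) (h₃ : ∀ i, Function.Bijective (φ.app i N₃))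
    (i : ℕ) : Function.Bijective (φ.app i N₂) := by
  constructor
  · rw [injective_iff_map_eq_zero]
    intro x hx
    have h4 : F.map i g x = 0 := by
      apply (h₃ i).1
      rw [φ.map, hx, map_zero, map_zero]
    obtain ⟨u, rfl⟩ := (F.exact_map i hf hg h x).1 h4
    rw [φ.map] at hx
    cases i with
    | zero =>
      have : φ.app 0 N₁ u = 0 := G.map_zero_injective hf (by rw [hx, map_zero])
      rw [(h₁ 0).1 (this.trans (map_zero _).symm), map_zero]
    | succ i =>
      obtain ⟨v, hv⟩ := (G.exact_δ_map i hf hg h _).1 hx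
      obtain ⟨w, rfl⟩ := (h₃ i).2 v
      rw [← φ.δ] at hv
      rw [← (h₁ _).1 hv]
      exact (F.exact_δ_map i hf hg h).apply_apply_eq_zero w
  · intro x
    obtain ⟨w, hw⟩ := (h₃ i).2 (G.map i g x)
    have hw' : F.δ i hf hg h w = 0 := by
      apply (h₁ _).1
      rw [φ.δ, hw, map_zero]
      exact (G.exact_map_δ i hf hg h).apply_apply_eq_zero x
    obtain ⟨u, rfl⟩ := (F.exact_map_δ i hf hg h w).1 hw'
    have hu : G.map i g (x - φ.app i N₂ u) = 0 := by
      rw [map_sub, ← φ.map, hw, sub_self]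
    obtain ⟨v, hv⟩ := (G.exact_map i hf hg h _).1 hu
    obtain ⟨v', rfl⟩ := (h₁ i).2 v
    refine ⟨u + F.map i f v', ?_⟩
    rw [map_add, φ.map, hv]
    abel

lemma bijective_of_prime {q : Ideal A} [q.IsPrime] {y : A} (hy : y ∉ q)
    (hF : ∀ i, ∀ x : F.obj i (A ⧸ q), ∃ n : ℕ, y ^ n • x = 0)
    (hG : ∀ i, ∀ x : G.obj i (A ⧸ q), ∃ n : ℕ, y ^ n • x = 0)
    (h : ∀ i, Function.Bijective (φ.app i (A ⧸ (q ⊔ Ideal.span {y})))) (i : ℕ) :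
    Function.Bijective (φ.app i (A ⧸ q)) := by
  have surj : ∀ i, (∀ x : G.obj i (A ⧸ q), y • x = 0 → ∃ u, φ.app i _ u = x) →
      Function.Surjective (φ.app i (A ⧸ q)) := by
    intro i H x
    obtain ⟨n, hn⟩ := hG i x
    induction n generalizing x with
    | zero => exact ⟨0, by rw [map_zero, ← one_smul A x, ← pow_zero y, hn]⟩
    | succ n ih =>
      obtain ⟨u, hu⟩ := ih (y • x) (by rwa [smul_smul, ← pow_succ])
      have h1 : F.map i (quotSup q y) u = 0 := by
        apply (h i).1
        rw [φ.map, hu, map_zero]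
        exact (G.exact_smul_map hy i).apply_apply_eq_zero x
      obtain ⟨u', rfl⟩ := (F.exact_smul_map hy i u).1 h1
      obtain ⟨w, hw⟩ := H (x - φ.app i _ u') (by
        rw [smul_sub, ← hu]
        simp only [map_smul, sub_self])
      exact ⟨w + u', by rw [map_add, hw, sub_add_cancel]⟩
  have inj : ∀ i, (∀ x : F.obj i (A ⧸ q), y • x = 0 → φ.app i _ x = 0 → x = 0) →
      Function.Injective (φ.app i (A ⧸ q)) := by
    intro i H
    rw [injective_iff_map_eq_zero]
    intro x hx
    obtain ⟨n, hn⟩ := hF i x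
    have := eq_zero_of_pow_smul_eq_zero (X := LinearMap.ker (φ.app i (A ⧸ q))) (y := y)
      (fun z hz => Subtype.ext (H z.1 (congrArg Subtype.val hz) z.2)) (n := n) (x := ⟨x, hx⟩)
      (Subtype.ext hn)
    exact congrArg Subtype.val this
  induction i with
  | zero =>
    refine ⟨inj 0 fun x hx _ => F.smul_injective_zero hy (by simpa using hx), surj 0 fun x hx =>
      ⟨0, ?_⟩⟩
    rw [map_zero, G.smul_injective_zero hy (a₁ := x) (a₂ := 0) (by simpa using hx)]
  | succ i ih =>
    refine ⟨inj _ fun z hz hz' => ?_, surj _ fun x hx => ?_⟩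
    · obtain ⟨w, rfl⟩ := (F.exact_δq_smul hy i z).1 hz
      rw [φ.δ] at hz'
      obtain ⟨v, hv⟩ := (G.exact_map_δq hy i _).1 hz'
      obtain ⟨v', rfl⟩ := ih.2 v
      rw [← φ.map] at hv
      rw [← (h i).1 hv]
      exact (F.exact_map_δq hy i).apply_apply_eq_zero v'
    · obtain ⟨v, rfl⟩ := (G.exact_δq_smul hy i x).1 hx
      obtain ⟨w, rfl⟩ := (h i).2 v
      exact ⟨F.δq hy i w, φ.δ _ _ _ _ _⟩

lemma bijective_of_subsingleton (N : Type) [AddCommGroup N] [Module A N] [Subsingleton N] (i : ℕ) :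
    Function.Bijective (φ.app i N) :=
  have := F.subsingleton_obj (N := N) i
  have := G.subsingleton_obj (N := N) i
  ⟨Function.injective_of_subsingleton _, Function.surjective_to_subsingleton _⟩

/-- A morphism of torsion cohomological functors which is an isomorphism on the killed domains
is an isomorphism. -/
theorem bijective [IsNoetherianRing A] {I J : Ideal A} (hF : F.Torsion J) (hG : G.Torsion J)
    (hφ : ∀ q : PrimeSpectrum A, I ≤ q.asIdeal → J ≤ q.asIdeal →
      ∀ i, Function.Bijective (φ.app i (A ⧸ q.asIdeal)))
    (N : Type) [AddCommGroup N] [Module A N] [Module.Finite A N]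
    (hN : I ≤ Module.annihilator A N) (i : ℕ) : Function.Bijective (φ.app i N) := by
  revert i
  revert hN
  refine fg_induction (A := A) (P := fun N _ _ => I ≤ Module.annihilator A N →
    ∀ i, Function.Bijective (φ.app i N)) ?_ ?_ ?_ N
  · exact fun N _ _ _ _ => φ.bijective_of_subsingleton N
  · intro N₁ N₂ N₃ _ _ _ _ _ _ _ _ _ f g hf hg h h₁ h₃ hI
    exact φ.bijective_of_exact hf hg h (h₁ (hI.trans (f.annihilator_le_of_injective hf)))
        (h₃ (hI.trans (g.annihilator_le_of_surjective hg)))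
  · intro q ih hI
    rw [Ideal.annihilator_quotient] at hI
    by_cases hJ : J ≤ q.asIdeal
    · exact hφ q hI hJ
    · obtain ⟨y, hyJ, hy⟩ := SetLike.not_le_iff_exists.1 hJ
      exact φ.bijective_of_prime hy (fun i x => hF i _ x y hyJ) (fun i x => hG i _ x y hyJ)
        (ih y hy (by rw [Ideal.annihilator_quotient]; exact hI.trans le_sup_left))

end DeltaHom
end DeltaHom

section Melkersson

lemma exists_forall_eq_of_antitone {α : Type*} [PartialOrder α] [WellFoundedLT α]
    (g : ℕ → ℕ → α) (hg₁ : ∀ k, Antitone fun i => g i k) (hg₂ : ∀ i, Antitone (g i)) :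
    ∃ i₀, ∀ i, i₀ ≤ i → ∀ k, g i k = g i₀ k := by
  have stab (h : ℕ → α) (hh : Antitone h) : ∃ n, ∀ m, n ≤ m → h m = h n := by
    obtain ⟨n, hn⟩ := WellFoundedGT.monotone_chain_condition (α := αᵒᵈ) ⟨h, hh⟩
    exact ⟨n, fun m hm => (hn m hm).symm⟩
  obtain ⟨n, hn⟩ := stab (fun n => g n n) fun i j hij => (hg₁ j hij).trans (hg₂ i hij)
  have hn' : ∀ i k, n ≤ i → n ≤ k → g i k = g n n := by
    intro i k hi hk
    refine le_antisymm ((hg₁ k hi).trans (hg₂ n hk)) ?_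
    rw [← hn (max i k) (hi.trans (le_max_left _ _))]
    exact (hg₁ _ (le_max_left i k)).trans (hg₂ i (le_max_right i k))
  choose s hs using fun k => stab (fun i => g i k) (hg₁ k)
  have hsup : ∀ k < n, s k ≤ (Finset.range n).sup s := fun k hk =>
    Finset.le_sup (f := s) (Finset.mem_range.2 hk)
  refine ⟨max n ((Finset.range n).sup s), fun i hi k => ?_⟩
  rcases le_or_gt n k with hk | hk
  · rw [hn' i k ((le_max_left _ _).trans hi) hk, hn' _ k (le_max_left _ _) hk]
  · exact (hs k i ((hsup k hk).trans ((le_max_right _ _).trans hi))).trans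
      (hs k _ ((hsup k hk).trans (le_max_right _ _))).symm

/-- A module which is torsion for an element `y` is Artinian as soon as the kernel of
multiplication by `y` is. -/
theorem isArtinian_of_torsion {A X : Type*} [CommRing A] [AddCommGroup X] [Module A X] (y : A)
    (hX : ∀ x : X, ∃ n : ℕ, y ^ n • x = 0) [IsArtinian A (LinearMap.ker (LinearMap.lsmul A X y))] :
    IsArtinian A X := by
  rw [← monotone_stabilizes_iff_artinian]
  intro f
  let N : ℕ → Submodule A X := fun i => OrderDual.ofDual (f i)
  have hN : Antitone N := fun i j hij => f.monotone hij
  set K := LinearMap.ker (LinearMap.lsmul A X y)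
  let g : ℕ → ℕ → Submodule A K := fun i k =>
    ((N i).map (LinearMap.lsmul A X (y ^ k))).comap K.subtype
  have mem_g : ∀ i k (x : K), x ∈ g i k ↔ ∃ z ∈ N i, y ^ k • z = x := fun i k x => Iff.rfl
  obtain ⟨i₀, hi₀⟩ := exists_forall_eq_of_antitone g
    (fun k i j hij x => by
      rintro ⟨z, hz, h⟩
      exact ⟨z, hN hij hz, h⟩)
    (fun i => antitone_nat_of_succ_le fun k x => by
      rintro ⟨z, hz, h⟩
      refine ⟨y • z, (N i).smul_mem _ hz, ?_⟩
      rw [← h]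
      simp only [LinearMap.lsmul_apply, smul_smul, pow_succ])
  refine ⟨i₀, fun i hi => ?_⟩
  suffices H : ∀ k : ℕ, ∀ x ∈ N i₀, y ^ k • x = 0 → x ∈ N i from
    le_antisymm (α := Submodule A X)
      (fun x hx => by obtain ⟨k, hk⟩ := hX x; exact H k x hx hk) (hN hi)
  intro k
  induction k with
  | zero => intro x _ h0; rw [pow_zero, one_smul] at h0; rw [h0]; exact zero_mem _
  | succ k ih =>
    intro x hx h0
    have hK : y ^ k • x ∈ K := by
      rw [LinearMap.mem_ker, LinearMap.lsmul_apply, smul_smul, ← pow_succ', h0]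
    obtain ⟨z, hz, h⟩ : (⟨_, hK⟩ : K) ∈ g i k := by
      rw [hi₀ i hi]
      exact ⟨x, hx, rfl⟩
    have h1 := ih (x - z) (sub_mem hx (hN hi hz)) (by
      rw [smul_sub, sub_eq_zero]
      exact h.symm)
    simpa using add_mem h1 hz

end Melkersson

namespace DeltaFun
variable {A : Type} [CommRing A] (G : DeltaFun A)

lemma coheight_lt_of_mem_support {q : PrimeSpectrum A} {y : A} (hy : y ∉ q.asIdeal) {e : ℕ}
    (hq : Order.coheight q < (e + 1 : ℕ)) {p : PrimeSpectrum A}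
    (hp : p ∈ Module.support A (A ⧸ (q.asIdeal ⊔ Ideal.span {y}))) : Order.coheight p < e := by
  have h := Module.annihilator_le_of_mem_support hp
  rw [Ideal.annihilator_quotient] at h
  have hlt : q < p := lt_of_le_of_ne (le_sup_left.trans h) (by
    rintro rfl
    exact hy (h (Ideal.mem_sup_right (Ideal.mem_span_singleton_self y))))
  have h2 : Order.coheight q ≤ e := by
    rw [Nat.cast_add, Nat.cast_one] at hq
    exact Order.le_of_lt_add_one hq
  exact Order.coheight_le_coe_iff.1 h2 p hlt

lemma mem_support_quotient (q : PrimeSpectrum A) : q ∈ Module.support A (A ⧸ q.asIdeal) := by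
  rw [Module.mem_support_iff_of_finite, Ideal.annihilator_quotient]

/-- Vanishing above the dimension. -/
theorem subsingleton_of_coheight_lt [IsNoetherianRing A] {J : Ideal A} (hG : G.Torsion J)
    (hJ : G.Vanish J) (N : Type) [AddCommGroup N] [Module A N] [Module.Finite A N] (e : ℕ)
    (h : ∀ p ∈ Module.support A N, Order.coheight p < e) (i : ℕ) (hi : e ≤ i) :
    Subsingleton (G.obj i N) := by
  revert e i
  refine fg_induction (A := A) (P := fun N _ _ => ∀ e : ℕ,
    (∀ p ∈ Module.support A N, Order.coheight p < e) → ∀ i, e ≤ i → Subsingleton (G.obj i N))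
    ?_ ?_ ?_ N
  · exact fun N _ _ _ _ _ _ _ => G.subsingleton_obj _
  · intro N₁ N₂ N₃ _ _ _ _ _ _ _ _ _ f g hf hg h h₁ h₃ e he i hi
    rw [Module.support_of_exact h hf hg] at he
    have := h₁ e (fun p hp => he p (Or.inl hp)) i hi
    have := h₃ e (fun p hp => he p (Or.inr hp)) i hi
    refine subsingleton_of_forall_eq 0 fun x => ?_
    obtain ⟨u, rfl⟩ := (G.exact_map i hf hg h x).1 (Subsingleton.elim _ _)
    rw [Subsingleton.elim u 0, map_zero]
  · intro q ih e he i hi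
    have hq := he q (mem_support_quotient q)
    cases e with
    | zero => simp at hq
    | succ e =>
    cases i with
    | zero => omega
    | succ i =>
    by_cases hJq : J ≤ q.asIdeal
    · exact hJ i _ (by rwa [Ideal.annihilator_quotient])
    · obtain ⟨y, hyJ, hy⟩ := SetLike.not_le_iff_exists.1 hJq
      have := ih y hy e (fun p hp => coheight_lt_of_mem_support hy hq hp) i (by omega)
      refine subsingleton_of_forall_eq 0 fun x => ?_
      obtain ⟨n, hn⟩ := hG _ _ x y hyJ
      refine eq_zero_of_pow_smul_eq_zero (fun x hx => ?_) hn
      obtain ⟨w, rfl⟩ := (G.exact_δq_smul hy i x).1 hx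
      rw [Subsingleton.elim w 0, map_zero]

/-- The top value is Artinian. -/
theorem isArtinian_of_coheight_lt [IsNoetherianRing A] {J : Ideal A} (hG : G.Torsion J)
    (hJ : G.Vanish J) (h0 : ∀ (N : Type) [AddCommGroup N] [Module A N], IsArtinian A N →
      IsArtinian A (G.obj 0 N))
    (N : Type) [AddCommGroup N] [Module A N] [Module.Finite A N] (d : ℕ)
    (h : ∀ p ∈ Module.support A N, Order.coheight p < (d + 1 : ℕ)) :
    IsArtinian A (G.obj d N) := by
  revert d
  refine fg_induction (A := A) (P := fun N _ _ => ∀ d : ℕ,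
    (∀ p ∈ Module.support A N, Order.coheight p < (d + 1 : ℕ)) → IsArtinian A (G.obj d N))
    ?_ ?_ ?_ N
  · intro N _ _ _ d _
    have := G.subsingleton_obj (N := N) d
    infer_instance
  · intro N₁ N₂ N₃ _ _ _ _ _ _ _ _ _ f g hf hg h h₁ h₃ d he
    rw [Module.support_of_exact h hf hg] at he
    have := h₁ d (fun p hp => he p (Or.inl hp))
    have := h₃ d (fun p hp => he p (Or.inr hp))
    exact isArtinian_of_range_eq_ker (G.map d f) (G.map d g)
      (G.exact_map d hf hg h).linearMap_ker_eq.symm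
  · intro q ih d hd
    have hq := hd q (mem_support_quotient q)
    cases d with
    | zero =>
      have hmax : q.asIdeal.IsMaximal := by
        rw [zero_add, Nat.cast_one, Order.lt_one_iff, Order.coheight_eq_zero] at hq
        exact (PrimeSpectrum.isMax_iff).1 hq
      refine h0 _ ?_
      let _ := Ideal.Quotient.field q.asIdeal
      have : IsArtinian (A ⧸ q.asIdeal) (A ⧸ q.asIdeal) := inferInstance
      exact isArtinian_of_surjective_algebraMap (S := A) (R := A ⧸ q.asIdeal)
        Ideal.Quotient.mk_surjective
    | succ d =>
    by_cases hJq : J ≤ q.asIdeal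
    · have := hJ d (A ⧸ q.asIdeal) (by rwa [Ideal.annihilator_quotient])
      infer_instance
    · obtain ⟨y, hyJ, hy⟩ := SetLike.not_le_iff_exists.1 hJq
      have := ih y hy d (fun p hp => coheight_lt_of_mem_support hy hq hp)
      have : IsArtinian A (LinearMap.ker (LinearMap.lsmul A (G.obj (d + 1) (A ⧸ q.asIdeal)) y)) :=
        isArtinian_of_surjective _ ((G.δq hy d).codRestrict _ fun w =>
          (G.exact_δq_smul hy d).apply_apply_eq_zero w) fun ⟨x, hx⟩ => by
          obtain ⟨w, rfl⟩ := (G.exact_δq_smul hy d x).1 hx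
          exact ⟨w, rfl⟩
      exact isArtinian_of_torsion y fun x => hG _ _ x y hyJ

end DeltaFun

section Dualizing
variable {A : Type} [CommRing A]

/-- An injective module such that the dual of any Artinian module is finitely generated, and
nonzero if the module is nonzero. -/
structure IsDualizing (A : Type) [CommRing A] (E : Type) [AddCommGroup E] [Module A E] : Prop where
  extend : ∀ {B B' : Type} [AddCommGroup B] [Module A B] [AddCommGroup B'] [Module A B']
    (f : B →ₗ[A] B'), Function.Injective f → ∀ φ : B →ₗ[A] E, ∃ ψ : B' →ₗ[A] E, ψ ∘ₗ f = φ
  finite : ∀ (B : Type) [AddCommGroup B] [Module A B], IsArtinian A B →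
    Module.Finite A (B →ₗ[A] E)
  nontrivial : ∀ (B : Type) [AddCommGroup B] [Module A B], IsArtinian A B → Nontrivial B →
    Nontrivial (B →ₗ[A] E)

/-- The associated primes of the dual of a module. -/
abbrev coassPrimes (A : Type) [CommRing A] (E : Type) [AddCommGroup E] [Module A E] (B : Type) [AddCommGroup B]
    [Module A B] : Set (Ideal A) := associatedPrimes A (B →ₗ[A] E)

variable {E : Type} [AddCommGroup E] [Module A E]
variable {B B' B'' : Type} [AddCommGroup B] [Module A B] [AddCommGroup B'] [Module A B']
  [AddCommGroup B''] [Module A B'']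

variable (E) in
lemma coassPrimes_subset_of_surjective (f : B →ₗ[A] B') (hf : Function.Surjective f) :
    coassPrimes A E B' ⊆ coassPrimes A E B :=
  associatedPrimes.subset_of_injective (LinearMap.lcomp_injective_of_surjective f hf)

variable (E) in
lemma coassPrimes_subset_of_exact {f : B →ₗ[A] B'} {g : B' →ₗ[A] B''} (h : Function.Exact f g)
    (hg : Function.Surjective g) : coassPrimes A E B' ⊆ coassPrimes A E B'' ∪ coassPrimes A E B :=
  associatedPrimes.subset_union_of_exact (LinearMap.lcomp_injective_of_surjective g hg)
    (LinearMap.exact_lcomp_of_exact_of_surjective _ h hg)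

end Dualizing

namespace DeltaFun
variable {A : Type} [CommRing A] (G : DeltaFun A)
variable {E : Type} [AddCommGroup E] [Module A E]

lemma smul_eq_zero_of_mem_annihilator {N : Type} [AddCommGroup N] [Module A N] {r : A}
    (hr : r ∈ Module.annihilator A N) (i : ℕ) (x : G.obj i N) : r • x = 0 := by
  rw [← G.map_smul_id, ← zero_smul A x, ← G.map_smul_id]
  congr 2
  ext n
  simp [Module.mem_annihilator.1 hr n]

/-- The coassociated primes of the top value: a version of the Lichtenbaum-Hartshorne theorem. -/
theorem isMaximal_of_mem_coassPrimes [IsNoetherianRing A] {J : Ideal A} (hG : G.Torsion J)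
    (hJ : G.Vanish J) (h0 : ∀ (N : Type) [AddCommGroup N] [Module A N], IsArtinian A N →
      IsArtinian A (G.obj 0 N)) (hE : IsDualizing A E)
    (N : Type) [AddCommGroup N] [Module A N] [Module.Finite A N] (d : ℕ)
    (h : ∀ p ∈ Module.support A N, Order.coheight p ≤ d)
    (p : PrimeSpectrum A) (hp : p.asIdeal ∈ coassPrimes A E (G.obj d N)) :
    (p ∈ Module.support A N ∧ Order.coheight p = d) ∧
      ∀ Q : Ideal A, Q.IsPrime → J ≤ Q → p.asIdeal ≤ Q → Q.IsMaximal := by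
  have lt_iff (d : ℕ) (q : PrimeSpectrum A) :
      Order.coheight q < (d + 1 : ℕ) ↔ Order.coheight q ≤ d := by
    rw [Nat.cast_add, Nat.cast_one]
    exact Order.lt_add_one_iff_of_not_isMax (by simp)
  revert p
  revert d
  refine fg_induction (A := A) (P := fun N _ _ => ∀ d : ℕ,
    (∀ p ∈ Module.support A N, Order.coheight p ≤ d) →
    ∀ p : PrimeSpectrum A, p.asIdeal ∈ coassPrimes A E (G.obj d N) →
    (p ∈ Module.support A N ∧ Order.coheight p = d) ∧
      ∀ Q : Ideal A, Q.IsPrime → J ≤ Q → p.asIdeal ≤ Q → Q.IsMaximal)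
    ?_ ?_ ?_ N
  · intro N _ _ _ d _ p hp
    have := G.subsingleton_obj (N := N) d
    exact (not_isAssociatedPrime_of_subsingleton hp).elim
  · intro N₁ N₂ N₃ _ _ _ _ _ _ _ _ _ f g hf hg h h₁ h₃ d he p hp
    rw [Module.support_of_exact h hf hg] at he ⊢
    have := G.subsingleton_of_coheight_lt hG hJ N₁ (d + 1)
      (fun p hp => (lt_iff d p).2 (he p (Or.inl hp))) (d + 1) le_rfl
    have hsurj : Function.Surjective (G.map d g) := fun x =>
      (G.exact_map_δ d hf hg h x).1 (Subsingleton.elim _ _)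
    rcases coassPrimes_subset_of_exact E (G.exact_map d hf hg h) hsurj hp with hp | hp
    · obtain ⟨⟨h1, h2⟩, h3⟩ := h₃ d (fun p hp => he p (Or.inr hp)) p hp
      exact ⟨⟨Or.inr h1, h2⟩, h3⟩
    · obtain ⟨⟨h1, h2⟩, h3⟩ := h₁ d (fun p hp => he p (Or.inl hp)) p hp
      exact ⟨⟨Or.inl h1, h2⟩, h3⟩
  · intro q ih d hd p hp
    have hq := hd q (mem_support_quotient q)
    have hart := G.isArtinian_of_coheight_lt hG hJ h0 (A ⧸ q.asIdeal) d
      (fun p hp => (lt_iff d p).2 (hd p hp))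
    have hfin := hE.finite _ hart
    have hle : q ≤ p := by
      intro r hr
      refine IsAssociatedPrime.annihilator_le hp (Submodule.mem_annihilator.2 fun φ _ => ?_)
      ext x
      rw [LinearMap.smul_apply, ← map_smul, G.smul_eq_zero_of_mem_annihilator, map_zero]
      · rfl
      · rwa [Ideal.annihilator_quotient]
    have hqd : Order.coheight q = d := by
      refine le_antisymm hq (le_of_not_gt fun hlt => ?_)
      have := G.subsingleton_of_coheight_lt hG hJ (A ⧸ q.asIdeal) d (fun p hp => by
        have h := Module.annihilator_le_of_mem_support hp
        rw [Ideal.annihilator_quotient] at h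
        exact (Order.coheight_anti (show q ≤ p from h)).trans_lt hlt) d le_rfl
      have : Subsingleton (G.obj d (A ⧸ q.asIdeal) →ₗ[A] E) :=
        ⟨fun a b => LinearMap.ext fun x => by rw [Subsingleton.elim x 0, map_zero, map_zero]⟩
      exact not_isAssociatedPrime_of_subsingleton hp
    have hpq : p = q := by
      refine le_antisymm (fun y hyp => ?_) hle
      by_contra hy
      have hsurj : ∀ x : G.obj d (A ⧸ q.asIdeal), ∃ z, y • z = x := by
        intro x
        refine (G.exact_smul_map hy d x).1 ?_
        cases d with
        | zero =>
          rw [Nat.cast_zero, Order.coheight_eq_zero] at hqd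
          have hmax := PrimeSpectrum.isMax_iff.1 hqd
          have htop : q.asIdeal ⊔ Ideal.span {y} = ⊤ := by
            exact hmax.1.2 _ (lt_of_le_of_ne le_sup_left fun h => hy (by
              rw [h]
              exact Ideal.mem_sup_right (Ideal.mem_span_singleton_self y)))
          have : Subsingleton (A ⧸ (q.asIdeal ⊔ Ideal.span {y})) :=
            Ideal.Quotient.subsingleton_iff.2 htop
          have := G.subsingleton_obj (N := (A ⧸ (q.asIdeal ⊔ Ideal.span {y}))) 0
          exact Subsingleton.elim _ _
        | succ d =>
          have := G.subsingleton_of_coheight_lt hG hJ _ (d + 1)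
            (fun p hp => coheight_lt_of_mem_support hy ((lt_iff _ _).2 hq) hp) _ le_rfl
          exact Subsingleton.elim _ _
      obtain ⟨-, φ, hφ⟩ := isAssociatedPrime_iff.1 hp
      have h1 : y • φ = 0 := by
        have : y ∈ p.asIdeal := hyp
        rw [hφ, Submodule.mem_colon_singleton] at this
        exact this
      have h2 : φ = 0 := by
        ext x
        obtain ⟨z, rfl⟩ := hsurj x
        rw [map_smul, ← LinearMap.smul_apply, h1]
        rfl
      rw [h2] at hφ
      exact p.2.ne_top (by rw [hφ]; simp)
    subst hpq
    refine ⟨⟨mem_support_quotient p, hqd⟩, fun Q hQ hJQ hpQ => ?_⟩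
    by_cases hQp : Q ≤ p.asIdeal
    · obtain rfl := le_antisymm hQp hpQ
      cases d with
      | zero => 
        rw [Nat.cast_zero, Order.coheight_eq_zero] at hqd
        exact PrimeSpectrum.isMax_iff.1 hqd
      | succ d =>
        have := hJ d (A ⧸ p.asIdeal) (by rwa [Ideal.annihilator_quotient])
        have : Subsingleton (G.obj (d + 1) (A ⧸ p.asIdeal) →ₗ[A] E) :=
          ⟨fun a b => LinearMap.ext fun x => by rw [Subsingleton.elim x 0, map_zero, map_zero]⟩
        exact (not_isAssociatedPrime_of_subsingleton hp).elim
    · obtain ⟨y, hyQ, hy⟩ := SetLike.not_le_iff_exists.1 hQp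
      cases d with
      | zero =>
        rw [Nat.cast_zero, Order.coheight_eq_zero] at hqd
        exact (hy ((PrimeSpectrum.isMax_iff.1 hqd).eq_of_le hQ.ne_top hpQ ▸ hyQ)).elim
      | succ d =>
      let D := G.obj (d + 1) (A ⧸ p.asIdeal) →ₗ[A] E
      let α : D →ₗ[A] (G.obj d (A ⧸ (p.asIdeal ⊔ Ideal.span {y})) →ₗ[A] E) :=
        LinearMap.lcomp A E (G.δq hy d)
      have hker : LinearMap.ker α ≤ Ideal.span {y} • (⊤ : Submodule A D) := by
        intro φ hφ
        have hz : ∀ x : G.obj (d + 1) (A ⧸ p.asIdeal), y • x = 0 → φ x = 0 := by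
          intro x hx
          obtain ⟨w, rfl⟩ := (G.exact_δq_smul hy d x).1 hx
          exact LinearMap.congr_fun hφ w
        let m := LinearMap.lsmul A (G.obj (d + 1) (A ⧸ p.asIdeal)) y
        obtain ⟨ψ, hψ⟩ := hE.extend ((LinearMap.ker m).liftQ m le_rfl)
          (LinearMap.ker_eq_bot.1 (Submodule.ker_liftQ_eq_bot _ _ _ le_rfl))
          ((LinearMap.ker m).liftQ φ fun x hx => hz x hx)
        have : φ = y • ψ := by
          ext x
          have := LinearMap.congr_fun hψ (Submodule.Quotient.mk x)
          exact this.symm.trans (ψ.map_smul y x)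
        rw [this]
        exact Submodule.smul_mem_smul (Ideal.mem_span_singleton_self y) trivial
      have hQsupp : (⟨Q, hQ⟩ : PrimeSpectrum A) ∈ Module.support A
          (D ⧸ (Ideal.span {y} • (⊤ : Submodule A D))) := by
        rw [Module.support_quotient]
        refine ⟨?_, ?_⟩
        · rw [Module.mem_support_iff_of_finite, ← Submodule.annihilator_top]
          exact (IsAssociatedPrime.annihilator_le hp).trans hpQ
        · rw [PrimeSpectrum.mem_zeroLocus]
          exact (Ideal.span_singleton_le_iff_mem Q).2 hyQ
      have hQrange : Module.annihilator A (D ⧸ LinearMap.ker α) ≤ Q :=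
        Module.annihilator_le_of_mem_support (p := ⟨Q, hQ⟩)
          (Module.support_subset_of_surjective (Submodule.factor hker)
            (Submodule.factor_surjective hker) hQsupp)
      obtain ⟨p', hp', hp'Q⟩ := Ideal.exists_minimalPrimes_le hQrange
      have hass := Module.associatedPrimes.minimalPrimes_annihilator_subset_associatedPrimes A _ hp'
      have hass' := associatedPrimes.subset_of_injective
        (f := (LinearMap.ker α).liftQ α le_rfl)
        (LinearMap.ker_eq_bot.1 (Submodule.ker_liftQ_eq_bot _ α _ le_rfl)) hass
      exact (ih y hy d (fun p' hp' => (lt_iff d p').1 (by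
        have := coheight_lt_of_mem_support hy ((lt_iff _ _).2 hq) hp'
        exact this)) ⟨p', hp'.1.1⟩ hass').2 Q hQ hJQ hp'Q

end DeltaFun

section Secondary
variable {A : Type} [CommRing A] {B : Type} [AddCommGroup B] [Module A B]

lemma mem_radical_annihilator {S : Submodule A B} {r : A} :
    r ∈ S.annihilator.radical ↔ ∃ n : ℕ, ∀ m ∈ S, r ^ n • m = 0 := by
  simp only [Ideal.mem_radical_iff, Submodule.mem_annihilator]

lemma IsSecondarySub.surjective {S : Submodule A B} (hS : IsSecondarySub A S) {r : A}
    (hr : r ∉ S.annihilator.radical) : ∀ m ∈ S, ∃ s ∈ S, r • s = m :=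
  (hS.2 r).resolve_right fun h => hr (mem_radical_annihilator.2 h)

lemma IsSecondarySub.sup {S S' : Submodule A B} (hS : IsSecondarySub A S)
    (hS' : IsSecondarySub A S') (h : S.annihilator.radical = S'.annihilator.radical) :
    IsSecondarySub A (S ⊔ S') := by
  refine ⟨fun h0 => hS.1 (eq_bot_iff.2 (h0 ▸ le_sup_left)), fun r => ?_⟩
  by_cases hr : r ∈ S.annihilator.radical
  · right
    obtain ⟨n, hn⟩ := mem_radical_annihilator.1 hr
    obtain ⟨n', hn'⟩ := mem_radical_annihilator.1 (h ▸ hr)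
    refine ⟨n + n', fun m hm => ?_⟩
    obtain ⟨u, hu, v, hv, rfl⟩ := Submodule.mem_sup.1 hm
    rw [smul_add, pow_add, mul_smul, mul_smul, hn' v hv, smul_zero, add_zero, smul_comm, hn u hu,
      smul_zero]
  · left
    intro m hm
    obtain ⟨u, hu, v, hv, rfl⟩ := Submodule.mem_sup.1 hm
    obtain ⟨u', hu', rfl⟩ := hS.surjective hr u hu
    obtain ⟨v', hv', rfl⟩ := hS'.surjective (h ▸ hr) v hv
    exact ⟨u' + v', Submodule.add_mem_sup hu' hv', smul_add _ _ _⟩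

/-- Every submodule of an Artinian module is a finite sum of secondary submodules. -/
lemma exists_finset_secondary [IsArtinian A B] (N : Submodule A B) :
    ∃ s : Finset (Submodule A B), (∀ S ∈ s, IsSecondarySub A S) ∧ s.sup id = N := by
  classical
  induction N using WellFoundedLT.induction with
  | ind N ih =>
  by_cases h0 : N = ⊥
  · exact ⟨∅, by simp, by simp [h0]⟩
  by_cases hN : IsSecondarySub A N
  · exact ⟨{N}, by simpa using hN, by simp⟩
  obtain ⟨r, hr⟩ : ∃ r : A, ¬ ((∀ m ∈ N, ∃ s ∈ N, r • s = m) ∨ ∃ n : ℕ, ∀ m ∈ N, r ^ n • m = 0) := by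
    by_contra! h
    exact hN ⟨h0, fun r => or_iff_not_imp_left.2 fun h' => (h r).resolve_left (by simpa using h')⟩
  rw [not_or] at hr
  let F : ℕ → Submodule A B := fun n => N.map (LinearMap.lsmul A B (r ^ n))
  have mem_F : ∀ n x, x ∈ F n ↔ ∃ z ∈ N, r ^ n • z = x := fun n x => Iff.rfl
  have hF : Antitone F := antitone_nat_of_succ_le fun n x => by
    rintro ⟨z, hz, rfl⟩
    refine ⟨r • z, N.smul_mem _ hz, ?_⟩
    simp only [LinearMap.lsmul_apply, smul_smul, pow_succ]
  have hFN : ∀ n, F n ≤ N := fun n x => by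
    rintro ⟨z, hz, rfl⟩
    exact N.smul_mem _ hz
  obtain ⟨n, hn⟩ := WellFoundedGT.monotone_chain_condition (α := (Submodule A B)ᵒᵈ) ⟨F, hF⟩
  replace hn : ∀ m, n ≤ m → F n = F m := hn
  have h1 : F n < N := by
    refine lt_of_le_of_ne (hFN n) fun h => hr.1 fun m hm => ?_
    rw [← h, hn (n + 1) (Nat.le_succ n), mem_F] at hm
    obtain ⟨z, hz, rfl⟩ := hm
    exact ⟨r ^ n • z, N.smul_mem _ hz, by rw [smul_smul, pow_succ']⟩
  have h2 : N ⊓ LinearMap.ker (LinearMap.lsmul A B (r ^ n)) < N := by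
    refine lt_of_le_of_ne inf_le_left fun h => hr.2 ⟨n, fun m hm => ?_⟩
    rw [← h] at hm
    exact hm.2
  obtain ⟨s, hs, hs'⟩ := ih _ h1
  obtain ⟨t, ht, ht'⟩ := ih _ h2
  refine ⟨s ∪ t, fun S hS => (Finset.mem_union.1 hS).elim (hs S) (ht S), ?_⟩
  rw [Finset.sup_union, hs', ht']
  refine le_antisymm (sup_le (hFN n) inf_le_left) fun x hx => ?_
  have hx1 : r ^ n • x ∈ F (n + n) := by
    rw [← hn (n + n) (Nat.le_add_left n n)]
    exact ⟨x, hx, rfl⟩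
  obtain ⟨z, hz, h⟩ := hx1
  refine Submodule.mem_sup.2 ⟨r ^ n • z, ⟨z, hz, rfl⟩, x - r ^ n • z,
    ⟨sub_mem hx (N.smul_mem _ hz), ?_⟩, by abel⟩
  rw [SetLike.mem_coe, LinearMap.mem_ker, LinearMap.lsmul_apply, smul_sub, sub_eq_zero, smul_smul,
    ← pow_add]
  exact h.symm

theorem exists_isMinimalRep [IsArtinian A B] :
    ∃ (n : ℕ) (S : Fin n → Submodule A B), IsMinimalRep A S := by
  classical
  have hex : ∃ n, ∃ s : Finset (Submodule A B), s.card = n ∧ (∀ S ∈ s, IsSecondarySub A S) ∧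
      s.sup id = ⊤ := by
    obtain ⟨s, h1, h2⟩ := exists_finset_secondary (⊤ : Submodule A B)
    exact ⟨_, s, rfl, h1, h2⟩
  obtain ⟨s, hcard, hs, hsup⟩ := Nat.find_spec hex
  have hmin : ∀ t : Finset (Submodule A B), (∀ S ∈ t, IsSecondarySub A S) → t.sup id = ⊤ →
      s.card ≤ t.card := fun t h1 h2 => hcard ▸ Nat.find_min' hex ⟨t, rfl, h1, h2⟩
  have herase : ∀ S ∈ s, ¬ S ≤ (s.erase S).sup id := by
    intro S hS h
    have := hmin (s.erase S) (fun S' hS' => hs S' (Finset.mem_of_mem_erase hS')) (by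
      rw [← hsup, ← Finset.insert_erase hS, Finset.sup_insert, Finset.erase_insert_eq_erase,
        Finset.erase_eq_of_notMem (Finset.notMem_erase _ _)]
      exact (sup_eq_right.2 h).symm)
    rw [Finset.card_erase_of_mem hS] at this
    have := Finset.card_pos.2 ⟨S, hS⟩
    omega
  have hrad : ∀ S ∈ s, ∀ S' ∈ s, S.annihilator.radical = S'.annihilator.radical → S = S' := by
    intro S hS S' hS' h
    by_contra hne
    have hS'' : S' ∈ s.erase S := Finset.mem_erase.2 ⟨Ne.symm hne, hS'⟩
    have := hmin (insert (S ⊔ S') ((s.erase S).erase S')) (fun U hU => by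
        rcases Finset.mem_insert.1 hU with rfl | hU
        · exact (hs S hS).sup (hs S' hS') h
        · exact hs U (Finset.mem_of_mem_erase (Finset.mem_of_mem_erase hU))) (by
      rw [← hsup, Finset.sup_insert]
      conv_rhs => rw [← Finset.insert_erase hS, ← Finset.insert_erase hS'', Finset.sup_insert,
        Finset.sup_insert]
      simp only [id, sup_assoc])
    have h1 := Finset.card_insert_le (S ⊔ S') ((s.erase S).erase S')
    rw [Finset.card_erase_of_mem hS'', Finset.card_erase_of_mem hS] at h1
    have := Finset.card_pos.2 ⟨S', hS''⟩
    rw [Finset.card_erase_of_mem hS] at this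
    omega
  let e := s.equivFin.symm
  refine ⟨s.card, fun i => (e i).1, fun i => hs _ (e i).2, ?_, fun i j hij => ?_, fun j hj => ?_⟩
  · rw [eq_top_iff, ← hsup]
    refine Finset.sup_le fun S hS => ?_
    have := le_iSup (fun i => (e i).1) (e.symm ⟨S, hS⟩)
    simpa using this
  · exact e.injective (Subtype.ext (hrad _ (e i).2 _ (e j).2 hij))
  · refine herase _ (e j).2 (hj.trans (iSup₂_le fun i hi => ?_))
    refine Finset.le_sup (f := id) (Finset.mem_erase.2 ⟨fun h => hi ?_, (e i).2⟩)
    exact e.injective (Subtype.ext h)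

/-- Attached primes are coassociated. -/
theorem attachedPrimes_subset_coassPrimes [IsNoetherianRing A] {E : Type} [AddCommGroup E]
    [Module A E] (hE : IsDualizing A E) [IsArtinian A B] :
    AttachedPrimes A B ⊆ coassPrimes A E B := by
  rintro p ⟨n, S, ⟨hS, hsup, -, hred⟩, i, rfl⟩
  set C := ⨆ j ∈ ({i}ᶜ : Set (Fin n)), S j
  have hC : S i ⊔ C = ⊤ := by
    rw [eq_top_iff, ← hsup]
    refine iSup_le fun j => ?_
    by_cases h : j = i
    · exact h ▸ le_sup_left
    · exact (le_iSup₂_of_le (f := fun j (_ : j ∈ ({i}ᶜ : Set (Fin n))) => S j) j h le_rfl).trans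
        le_sup_right
  have hmk : ∀ x : B ⧸ C, ∃ z ∈ S i, Submodule.Quotient.mk z = x := by
    intro x
    obtain ⟨x, rfl⟩ := Submodule.Quotient.mk_surjective _ x
    obtain ⟨u, hu, v, hv, rfl⟩ := Submodule.mem_sup.1 (hC ▸ Submodule.mem_top (x := x))
    exact ⟨u, hu, by simpa [Submodule.Quotient.eq] using hv⟩
  have hnt : Nontrivial (B ⧸ C) := by
    rw [Submodule.Quotient.nontrivial_iff]
    intro h
    exact hred i (le_top.trans h.ge)
  have := hE.nontrivial (B ⧸ C) inferInstance hnt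
  obtain ⟨q, hq⟩ := associatedPrimes.nonempty A (B ⧸ C →ₗ[A] E)
  refine coassPrimes_subset_of_surjective E C.mkQ (Submodule.mkQ_surjective _) ?_
  suffices (S i).annihilator.radical = q from this ▸ hq
  have hq' := hq.isPrime
  refine le_antisymm ?_ fun r hr => ?_
  · rw [hq'.radical_le_iff]
    intro r hr
    refine IsAssociatedPrime.annihilator_le hq (Submodule.mem_annihilator.2 fun φ _ => ?_)
    ext x
    obtain ⟨z, hz, h⟩ := hmk (C.mkQ x)
    change r • φ (C.mkQ x) = 0
    rw [← h, ← map_smul, ← Submodule.Quotient.mk_smul, Submodule.mem_annihilator.1 hr z hz,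
      Submodule.Quotient.mk_zero, map_zero]
  · by_contra hr'
    obtain ⟨-, φ, hφ⟩ := isAssociatedPrime_iff.1 hq
    have h1 : r • φ = 0 := by
      rw [hφ, Submodule.mem_colon_singleton] at hr
      exact hr
    have h2 : φ = 0 := by
      refine LinearMap.ext fun x => ?_
      obtain ⟨z, hz, rfl⟩ := hmk x
      obtain ⟨w, hw, rfl⟩ := (hS i).surjective hr' z hz
      rw [Submodule.Quotient.mk_smul, map_smul, ← LinearMap.smul_apply, h1]
      rfl
    rw [h2] at hφ
    exact hq'.ne_top (by rw [hφ]; simp)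

lemma IsMinimalRep.exists_le {n : ℕ} {S : Fin n → Submodule A B} (hS : IsMinimalRep A S)
    {q : Ideal A} [hq : q.IsPrime] (h : Module.annihilator A B ≤ q) :
    ∃ i, (S i).annihilator.radical ≤ q := by
  have : ∏ i, (S i).annihilator ≤ q := by
    refine le_trans ?_ h
    refine (Ideal.prod_le_inf).trans fun r hr => Module.mem_annihilator.2 fun x => ?_
    have hle : ⨆ i, S i ≤ LinearMap.ker (LinearMap.lsmul A B r) := iSup_le fun i z hz => by
      have : r ∈ (S i).annihilator := by
        exact (Finset.inf_le (f := fun i => (S i).annihilator) (Finset.mem_univ i)) hr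
      exact Submodule.mem_annihilator.1 this z hz
    rw [hS.2.1] at hle
    exact hle (Submodule.mem_top (x := x))
  obtain ⟨i, -, hi⟩ := (Ideal.IsPrime.prod_le hq).1 this
  exact ⟨i, hq.radical_le_iff.2 hi⟩

end Secondary

section TopValue
variable {A : Type} [CommRing A]

/-- The formal properties of local cohomology with support in `J`. -/
structure DeltaFun.IsSupported (G : DeltaFun A) (J : Ideal A) : Prop where
  torsion : G.Torsion J
  vanish : G.Vanish J
  artinian_zero : ∀ (N : Type) [AddCommGroup N] [Module A N], IsArtinian A N →
    IsArtinian A (G.obj 0 N)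

variable [IsNoetherianRing A] {E : Type} [AddCommGroup E] [Module A E] (hE : IsDualizing A E)
variable (N : Type) [AddCommGroup N] [Module A N] [Module.Finite A N] (d : ℕ)

lemma DeltaFun.IsSupported.isArtinian {G : DeltaFun A} {J : Ideal A} (hG : G.IsSupported J)
    (h : ∀ p ∈ Module.support A N, Order.coheight p ≤ d) : IsArtinian A (G.obj d N) :=
  G.isArtinian_of_coheight_lt hG.torsion hG.vanish hG.artinian_zero N d fun p hp =>
    (h p hp).trans_lt (by exact_mod_cast Nat.lt_succ_self d)

/-- If `p i` are primes of the support of `N` of maximal coheight `d`, there is a submodule `K` with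
no `p i` in its support such that the primes in the support of `N ⧸ K` contain some `p i`. -/
lemma exists_submodule_support (h : ∀ p ∈ Module.support A N, Order.coheight p ≤ d)
    {n : ℕ} (p : Fin n → PrimeSpectrum A) (hp : ∀ i, p i ∈ Module.support A N)
    (hpd : ∀ i, Order.coheight (p i) = d) :
    ∃ K : Submodule A N, (∀ i, p i ∉ Module.support A K) ∧
      ∀ q : Ideal A, q.IsPrime → Module.annihilator A (N ⧸ K) ≤ q → ∃ i, (p i).asIdeal ≤ q := by
  set I := Module.annihilator A N
  set J : Ideal A := Finset.univ.inf fun i => (p i).asIdeal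
  have hpI : ∀ i, I ≤ (p i).asIdeal := fun i => Module.annihilator_le_of_mem_support (hp i)
  have hmin : ∀ i, ∀ q : Ideal A, q.IsPrime → I ≤ q → q ≤ (p i).asIdeal → q = (p i).asIdeal := by
    intro i q hq hIq hqp
    by_contra hne
    have hq' : (⟨q, hq⟩ : PrimeSpectrum A) ∈ Module.support A N :=
      Module.mem_support_iff_of_finite.2 hIq
    have hlt : (⟨q, hq⟩ : PrimeSpectrum A) < p i :=
      lt_of_le_of_ne hqp fun h => hne (congrArg PrimeSpectrum.asIdeal h)
    exact (hpd i).not_lt (Order.coheight_le_coe_iff.1 (h _ hq') _ hlt)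
  have hfin : I.minimalPrimes.Finite := I.finite_minimalPrimes_of_isNoetherianRing A
  set s := hfin.toFinset.filter fun q => ∀ i, q ≠ (p i).asIdeal
  set L : Ideal A := s.inf id
  have hJL : J ⊓ L ≤ I.radical := by
    rw [← Ideal.sInf_minimalPrimes]
    refine le_sInf fun q hq => ?_
    by_cases hqp : ∀ i, q ≠ (p i).asIdeal
    · exact inf_le_right.trans (Finset.inf_le (f := id)
        (Finset.mem_filter.2 ⟨hfin.mem_toFinset.2 hq, hqp⟩))
    · push Not at hqp
      obtain ⟨i, rfl⟩ := hqp
      exact inf_le_left.trans (Finset.inf_le (f := fun i => (p i).asIdeal) (Finset.mem_univ i))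
  obtain ⟨k, hk⟩ := Ideal.exists_radical_pow_le_of_fg I (IsNoetherian.noetherian _)
  have hJLk : L ^ k * J ^ k ≤ I := by
    rw [← mul_pow]
    exact (Ideal.pow_right_mono (Ideal.mul_le_inf.trans (inf_comm L J ▸ hJL)) k).trans hk
  refine ⟨J ^ k • ⊤, fun i hi => ?_, fun q hq hKq => ?_⟩
  · have hLp : L ^ k ≤ (p i).asIdeal := by
      refine le_trans (fun r hr => ?_) (Module.annihilator_le_of_mem_support hi)
      refine Module.mem_annihilator.2 fun ⟨x, hx⟩ => Subtype.ext ?_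
      change r • x = 0
      have : r • x ∈ L ^ k • (J ^ k • ⊤ : Submodule A N) := Submodule.smul_mem_smul hr hx
      rw [← mul_smul] at this
      have h0 : (L ^ k * J ^ k) • (⊤ : Submodule A N) ≤ ⊥ := by
        rw [le_bot_iff, ← Submodule.le_annihilator_iff, Submodule.annihilator_top]
        exact hJLk
      exact h0 this
    have := (p i).2
    obtain ⟨q, hq, hqp⟩ := (Ideal.IsPrime.inf_le' (p i).2).1 (Ideal.IsPrime.le_of_pow_le hLp)
    obtain ⟨hq1, hq2⟩ := Finset.mem_filter.1 hq
    rw [Set.Finite.mem_toFinset] at hq1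
    exact hq2 i (hmin i q hq1.1.1 hq1.1.2 hqp)
  · have hJq : J ≤ q := by
      refine Ideal.IsPrime.le_of_pow_le (n := k) (le_trans (fun r hr => ?_) hKq)
      refine Module.mem_annihilator.2 fun x => ?_
      obtain ⟨x, rfl⟩ := Submodule.Quotient.mk_surjective _ x
      rw [← Submodule.Quotient.mk_smul, Submodule.Quotient.mk_eq_zero]
      exact Submodule.smul_mem_smul hr trivial
    obtain ⟨i, -, hi⟩ := (Ideal.IsPrime.inf_le' hq).1 hJq
    exact ⟨i, hi⟩

include hE in
/-- Comparison of the top values of two supported cohomological functors. -/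
theorem exists_surjective_of_attachedPrimes {Ga Gb Gc : DeltaFun A} {Ja Jb 𝔪 : Ideal A}
    (hGa : Ga.IsSupported Ja) (hGb : Gb.IsSupported Jb) (hGc : Gc.IsSupported (Ja ⊔ Jb))
    (φa : DeltaHom Gc Ga) (φb : DeltaHom Gc Gb)
    (hφa : ∀ q : PrimeSpectrum A, Ja ⊔ Jb ≤ q.asIdeal →
      ∀ i, Function.Bijective (φa.app i (A ⧸ q.asIdeal)))
    (hφb : ∀ q : PrimeSpectrum A, Ja ⊔ Jb ≤ q.asIdeal →
      ∀ i, Function.Bijective (φb.app i (A ⧸ q.asIdeal)))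
    (h𝔪 : ∀ Q : Ideal A, Q.IsMaximal → 𝔪 ≤ Q) (hJa : Ja ≤ 𝔪) (hJb : Jb ≤ 𝔪)
    (h : ∀ p ∈ Module.support A N, Order.coheight p ≤ d)
    (hcase : Ja ≤ Jb ∨ AttachedPrimes A (Ga.obj d N) ⊆ AttachedPrimes A (Gb.obj d N)) :
    ∃ f : Gb.obj d N →ₗ[A] Ga.obj d N, Function.Surjective f := by
  have hart := hGa.isArtinian N d h
  have hartb := hGb.isArtinian N d h
  obtain ⟨n, S, hS⟩ := exists_isMinimalRep (A := A) (B := Ga.obj d N)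
  have hatt : ∀ i, (S i).annihilator.radical ∈ AttachedPrimes A (Ga.obj d N) :=
    fun i => ⟨n, S, hS, i, rfl⟩
  have hco : ∀ i, (S i).annihilator.radical ∈ coassPrimes A E (Ga.obj d N) :=
    fun i => attachedPrimes_subset_coassPrimes hE (hatt i)
  let p : Fin n → PrimeSpectrum A := fun i => ⟨(S i).annihilator.radical, (hco i).isPrime⟩
  have hLHa := fun i => Ga.isMaximal_of_mem_coassPrimes hGa.torsion hGa.vanish hGa.artinian_zero hE
    N d h (p i) (hco i)
  obtain ⟨K, hK, hNK⟩ := exists_submodule_support N d h p (fun i => (hLHa i).1.1)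
    (fun i => (hLHa i).1.2)
  have hexact : Function.Exact K.subtype K.mkQ := LinearMap.exact_subtype_mkQ K
  have hsuppK := fun q hq => h q (Module.support_subset_of_injective _ K.injective_subtype hq)
  have hsurj {G : DeltaFun A} {J : Ideal A} (hG : G.IsSupported J) :
      Function.Surjective (G.map d K.mkQ) := fun x => by
    have := G.subsingleton_of_coheight_lt hG.torsion hG.vanish K (d + 1)
      (fun q hq => (hsuppK q hq).trans_lt (by exact_mod_cast Nat.lt_succ_self d)) (d + 1) le_rfl
    exact (G.exact_map_δ d K.injective_subtype K.mkQ_surjective hexact x).1 (Subsingleton.elim _ _)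
  have hinj : Function.Injective (Ga.map d K.mkQ) := by
    rw [injective_iff_map_eq_zero]
    intro x hx
    rw [← LinearMap.mem_ker,
      (Ga.exact_map d K.injective_subtype K.mkQ_surjective hexact).linearMap_ker_eq] at hx
    by_contra hne
    set X := LinearMap.range (Ga.map d K.subtype)
    have hX : Nontrivial X := ⟨⟨⟨x, hx⟩, 0, fun h => hne (congrArg Subtype.val h)⟩⟩
    have := hE.nontrivial X inferInstance hX
    obtain ⟨q, hq⟩ := associatedPrimes.nonempty A (X →ₗ[A] E)
    have hq' := hq.isPrime
    have hqK : q ∈ coassPrimes A E (Ga.obj d K) :=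
      coassPrimes_subset_of_surjective E (Ga.map d K.subtype).rangeRestrict
        (LinearMap.surjective_rangeRestrict _) hq
    obtain ⟨⟨h1, h2⟩, -⟩ := Ga.isMaximal_of_mem_coassPrimes hGa.torsion hGa.vanish
      hGa.artinian_zero hE K d hsuppK ⟨q, hq'⟩ hqK
    obtain ⟨i, hi⟩ := hS.exists_le (q := q) (by
      refine le_trans (fun r hr => ?_) (IsAssociatedPrime.annihilator_le hq)
      refine Submodule.mem_annihilator.2 fun φ _ => LinearMap.ext fun z => ?_
      rw [LinearMap.smul_apply, ← map_smul, show r • z = 0 from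
        Subtype.ext (Module.mem_annihilator.1 hr z.1), map_zero]
      rfl)
    rcases eq_or_lt_of_le (show p i ≤ ⟨q, hq'⟩ from hi) with heq | hlt
    · exact hK i (heq ▸ h1)
    · exact h2.not_lt (Order.coheight_le_coe_iff.1 (hLHa i).1.2.le _ hlt)
  have hQa : ∀ q : PrimeSpectrum A, Module.annihilator A (N ⧸ K) ≤ q.asIdeal → Ja ≤ q.asIdeal →
      Ja ⊔ Jb ≤ q.asIdeal := by
    intro q hq hJq
    obtain ⟨i, hi⟩ := hNK _ q.2 hq
    exact sup_le hJq (hJb.trans (h𝔪 _ ((hLHa i).2 _ q.2 hJq hi)))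
  have hQb : ∀ q : PrimeSpectrum A, Module.annihilator A (N ⧸ K) ≤ q.asIdeal → Jb ≤ q.asIdeal →
      Ja ⊔ Jb ≤ q.asIdeal := by
    intro q hq hJq
    rcases hcase with hab | hatt'
    · exact sup_le (hab.trans hJq) hJq
    obtain ⟨i, hi⟩ := hNK _ q.2 hq
    have hmax := (Gb.isMaximal_of_mem_coassPrimes hGb.torsion hGb.vanish hGb.artinian_zero hE
      N d h (p i) (attachedPrimes_subset_coassPrimes hE (hatt' (hatt i)))).2 _ q.2 hJq hi
    exact sup_le (hJa.trans (h𝔪 _ hmax)) hJq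
  have torsion_mono {G : DeltaFun A} {J J' : Ideal A} (hJ : J ≤ J') (hG : G.Torsion J') :
      G.Torsion J := fun i N _ _ x y hy => hG i N x y (hJ hy)
  have hba := φa.bijective (I := Module.annihilator A (N ⧸ K))
    (torsion_mono le_sup_left hGc.torsion) hGa.torsion
    (fun q h1 h2 => hφa q (hQa q h1 h2)) (N ⧸ K) le_rfl d
  have hbb := φb.bijective (I := Module.annihilator A (N ⧸ K))
    (torsion_mono le_sup_right hGc.torsion) hGb.torsion
    (fun q h1 h2 => hφb q (hQb q h1 h2)) (N ⧸ K) le_rfl d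
  let ea := LinearEquiv.ofBijective _ hba
  let eb := LinearEquiv.ofBijective _ hbb
  let e := LinearEquiv.ofBijective (Ga.map d K.mkQ) ⟨hinj, hsurj hGa⟩
  refine ⟨e.symm.toLinearMap ∘ₗ ea.toLinearMap ∘ₗ eb.symm.toLinearMap ∘ₗ Gb.map d K.mkQ, ?_⟩
  exact e.symm.surjective.comp (ea.surjective.comp (eb.symm.surjective.comp (hsurj hGb)))

end TopValue

section InjectiveHull
variable {A : Type} [CommRing A]

/-- The elements of `X` all have nonzero multiples in `W`. -/
def EssentialOver {I : Type} [AddCommGroup I] [Module A I] (W X : Submodule A I) : Prop :=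
  ∀ x ∈ X, x ≠ 0 → ∃ a : A, a • x ∈ W ∧ a • x ≠ 0

/-- Every module has an essential extension with the extension property of injective modules. -/
lemma exists_injective_hull (W : Type) [AddCommGroup W] [Module A W] :
    ∃ (E : Type) (_ : AddCommGroup E) (_ : Module A E) (f : W →ₗ[A] E),
      Function.Injective f ∧
      (∀ x : E, x ≠ 0 → ∃ a : A, a • x ∈ LinearMap.range f ∧ a • x ≠ 0) ∧
      ∀ {B B' : Type} [AddCommGroup B] [Module A B] [AddCommGroup B'] [Module A B']
        (g : B →ₗ[A] B'), Function.Injective g → ∀ φ : B →ₗ[A] E,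
          ∃ ψ : B' →ₗ[A] E, ψ ∘ₗ g = φ := by
  obtain ⟨I, _, _, hI, f, hf⟩ := exists_injective_embedding A W
  obtain ⟨E, hWE, hE⟩ := zorn_le_nonempty₀ {X : Submodule A I | EssentialOver (LinearMap.range f) X}
    (fun c hc hchain y hy => by
      refine ⟨sSup c, fun x hx hx0 => ?_, fun z hz => le_sSup hz⟩
      obtain ⟨X, hX, hxX⟩ := (Submodule.mem_sSup_of_directed ⟨y, hy⟩ hchain.directedOn).1 hx
      exact hc hX x hxX hx0)
    (LinearMap.range f) (fun x hx hx0 => ⟨1, by simpa using hx, by simpa using hx0⟩)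
  obtain ⟨C, -, hC⟩ := zorn_le_nonempty₀ {C : Submodule A I | ∀ x ∈ C, x ∈ E → x = 0}
    (fun c hc hchain y hy => by
      refine ⟨sSup c, fun x hx hxE => ?_, fun z hz => le_sSup hz⟩
      obtain ⟨X, hX, hxX⟩ := (Submodule.mem_sSup_of_directed ⟨y, hy⟩ hchain.directedOn).1 hx
      exact hc hX x hxX hxE)
    ⊥ (fun x hx _ => by simpa using hx)
  have key (x : I) (hx : x ∉ C) : ∃ a : A, ∃ e ∈ E, e ≠ 0 ∧ C.mkQ e = a • C.mkQ x := by
    by_contra! hcon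
    refine hx (hC.2 (y := C ⊔ Submodule.span A {x}) ?_ le_sup_left
      (Submodule.mem_sup_right (Submodule.mem_span_singleton_self x)))
    intro e he heE
    obtain ⟨c, hc, z, hz, rfl⟩ := Submodule.mem_sup.1 he
    obtain ⟨a, rfl⟩ := Submodule.mem_span_singleton.1 hz
    by_contra h0
    refine hcon a _ heE h0 ?_
    rw [map_add, (Submodule.Quotient.mk_eq_zero C).2 hc |> fun h => (h : C.mkQ c = 0), zero_add,
      map_smul]
  have hj : Function.Injective (C.mkQ ∘ₗ E.subtype) := by
    rw [← LinearMap.ker_eq_bot, LinearMap.ker_eq_bot']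
    intro e he
    exact Subtype.ext (hC.1 e ((Submodule.Quotient.mk_eq_zero C).1 he) e.2)
  obtain ⟨g, hg⟩ := hI.out (C.mkQ ∘ₗ E.subtype) hj E.subtype
  have hrange : EssentialOver (LinearMap.range f) (LinearMap.range g) := by
    rintro _ ⟨x, rfl⟩ hx0
    obtain ⟨x, rfl⟩ := C.mkQ_surjective x
    have hx : x ∉ C := fun h => hx0 (by
      rw [(Submodule.Quotient.mk_eq_zero C).2 h |> fun h => (h : C.mkQ x = 0), map_zero])
    obtain ⟨a, e, he, he0, hex⟩ := key x hx
    obtain ⟨b, hb, hb0⟩ := hE.1 e he he0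
    have : e = a • g (C.mkQ x) := by
      rw [← map_smul, ← hex]
      exact (hg ⟨e, he⟩).symm
    rw [this, smul_smul] at hb hb0
    exact ⟨b * a, hb, hb0⟩
  have hle : LinearMap.range g ≤ E :=
    hE.2 hrange fun e he => ⟨C.mkQ e, hg ⟨e, he⟩⟩
  refine ⟨E, inferInstance, inferInstance, f.codRestrict E fun w => hWE ⟨w, rfl⟩, ?_, ?_, ?_⟩
  · exact fun x y h => hf (congrArg Subtype.val h)
  · intro x hx0
    obtain ⟨a, ⟨w, hw⟩, ha0⟩ := hE.1 x x.2 (by simpa using hx0)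
    exact ⟨a, ⟨w, Subtype.ext hw⟩, fun h => ha0 (congrArg Subtype.val h)⟩
  · intro B B' _ _ _ _ u hu φ
    obtain ⟨h, hh⟩ := hI.out u hu (E.subtype ∘ₗ φ)
    refine ⟨(g ∘ₗ C.mkQ ∘ₗ h).codRestrict E fun x => hle ⟨_, rfl⟩, ?_⟩
    ext x
    have h1 : h (u x) = φ x := hh x
    have h2 := hg (φ x)
    simp only [LinearMap.comp_apply, Submodule.subtype_apply] at h2
    exact (congrArg (fun y => g (C.mkQ y)) h1).trans h2

end InjectiveHull

section Complete
variable {A : Type} [CommRing A] {𝔪 : Ideal A}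

lemma isPrecomplete_pi [IsPrecomplete 𝔪 A] (n : ℕ) : IsPrecomplete 𝔪 (Fin n → A) := by
  rw [← AdicCompletion.of_surjective_iff]
  intro x
  choose a ha using fun j => AdicCompletion.of_surjective 𝔪 A (AdicCompletion.piEquivFin 𝔪 n x j)
  refine ⟨a, (AdicCompletion.piEquivFin 𝔪 n).injective ?_⟩
  ext j : 1
  rw [← ha j]
  rfl

/-- Over a complete ring, a separated module which is finite modulo the ideal is finite. -/
lemma finite_of_isHausdorff [IsPrecomplete 𝔪 A] {D : Type} [AddCommGroup D] [Module A D]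
    [IsHausdorff 𝔪 D] (h : Module.Finite A (D ⧸ (𝔪 • ⊤ : Submodule A D))) : Module.Finite A D := by
  obtain ⟨n, f, hf⟩ := Module.Finite.exists_fin' A (D ⧸ (𝔪 • ⊤ : Submodule A D))
  obtain ⟨g, hg⟩ := Module.projective_lifting_property (𝔪 • ⊤ : Submodule A D).mkQ f
    (Submodule.mkQ_surjective _)
  have := isPrecomplete_pi (𝔪 := 𝔪) n
  exact Module.Finite.of_surjective g (surjective_of_mkQ_comp_surjective (I := 𝔪) (by rwa [hg]))

end Complete

section Dualizing
variable {A : Type} [CommRing A] {𝔪 : Ideal A}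

lemma isSemisimpleModule_quotient [IsSemisimpleRing (A ⧸ 𝔪)] : IsSemisimpleModule A (A ⧸ 𝔪) := by
  let f : (A ⧸ 𝔪) →ₛₗ[Ideal.Quotient.mk 𝔪] (A ⧸ 𝔪) :=
    { toFun := id, map_add' := fun _ _ => rfl, map_smul' := fun _ _ => rfl }
  have : RingHomSurjective (Ideal.Quotient.mk 𝔪) := ⟨Ideal.Quotient.mk_surjective⟩
  exact (LinearMap.isSemisimpleModule_iff_of_bijective f Function.bijective_id).2 inferInstance

lemma mem_of_essential [IsSemisimpleRing (A ⧸ 𝔪)] {E : Type} [AddCommGroup E] [Module A E]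
    {W : Submodule A E} (hW : ∀ x : E, x ≠ 0 → ∃ a : A, a • x ∈ W ∧ a • x ≠ 0) {x : E}
    (hx : ∀ r ∈ 𝔪, r • x = 0) : x ∈ W := by
  have := isSemisimpleModule_quotient (𝔪 := 𝔪)
  let φ : (A ⧸ 𝔪) →ₗ[A] E := Submodule.liftQ 𝔪 (LinearMap.toSpanSingleton A E x)
    (fun r hr => by simpa using hx r hr)
  obtain ⟨C, hC⟩ := exists_isCompl (W.comap φ)
  have hle : C ≤ W.comap φ := by
    intro c hc
    by_contra hcon
    have h0 : φ c ≠ 0 := fun h => hcon (by simp [h])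
    obtain ⟨a, ha, ha0⟩ := hW _ h0
    rw [← map_smul] at ha ha0
    exact ha0 (by rw [Submodule.disjoint_def.1 hC.disjoint (a • c) ha (C.smul_mem a hc), map_zero])
  have htop : W.comap φ = ⊤ := by rw [← hC.sup_eq_top, sup_eq_left.2 hle]
  have h1 : Ideal.Quotient.mk 𝔪 1 ∈ W.comap φ := htop ▸ Submodule.mem_top
  have h2 : φ (Ideal.Quotient.mk 𝔪 1) = x := by
    change (1 : A) • x = x
    simp
  rw [← h2]
  exact h1

lemma exists_pow_smul_eq_zero_of_isArtinian [IsNoetherianRing A] (h𝔪 : 𝔪 ≤ Ideal.jacobson ⊥)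
    {B : Type} [AddCommGroup B] [Module A B] [IsArtinian A B] (x : B) :
    ∃ n, ∀ r ∈ 𝔪 ^ n, r • x = 0 := by
  obtain ⟨n, hn⟩ := IsArtinian.monotone_stabilizes (R := A) (M := B)
    ⟨fun n => OrderDual.toDual (𝔪 ^ n • Submodule.span A {x}), fun m n h =>
      Submodule.smul_mono_left (Ideal.pow_le_pow_right h)⟩
  have h1 : 𝔪 ^ n • Submodule.span A {x} = 𝔪 ^ (n + 1) • Submodule.span A {x} :=
    hn (n + 1) n.le_succ
  have h2 : 𝔪 ^ n • Submodule.span A {x} = ⊥ := by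
    refine Submodule.eq_bot_of_le_smul_of_le_jacobson_bot 𝔪 _ ?_ ?_ h𝔪
    · exact Submodule.FG.smul (IsNoetherian.noetherian (𝔪 ^ n)) (Submodule.fg_span_singleton x)
    · rw [← Submodule.mul_smul, ← pow_succ', ← h1]
  refine ⟨n, fun r hr => ?_⟩
  have := Submodule.smul_mem_smul hr (Submodule.mem_span_singleton_self (R := A) x)
  rwa [h2] at this

/-- A complete semilocal Noetherian ring has a dualizing module. -/
theorem exists_isDualizing [IsNoetherianRing A] [IsAdicComplete 𝔪 A] [IsSemisimpleRing (A ⧸ 𝔪)] :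
    ∃ (E : Type) (_ : AddCommGroup E) (_ : Module A E), IsDualizing A E := by
  have h𝔪 : 𝔪 ≤ Ideal.jacobson ⊥ := IsAdicComplete.le_jacobson_bot 𝔪
  have hss := isSemisimpleModule_quotient (𝔪 := 𝔪)
  obtain ⟨E, _, _, f, hf, hess, hext⟩ := exists_injective_hull (A := A) (A ⧸ 𝔪)
  refine ⟨E, inferInstance, inferInstance, fun g hg φ => hext g hg φ, ?_, ?_⟩
  · intro B _ _ _
    have : IsHausdorff 𝔪 (B →ₗ[A] E) := by
      refine ⟨fun g hg => LinearMap.ext fun x => ?_⟩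
      obtain ⟨n, hn⟩ := exists_pow_smul_eq_zero_of_isArtinian h𝔪 x
      have hgn := SModEq.zero.1 (hg n)
      suffices ∀ g' ∈ (𝔪 ^ n • ⊤ : Submodule A (B →ₗ[A] E)), g' x = 0 from this g hgn
      intro g' hg'
      refine Submodule.smul_induction_on hg' (fun r hr u _ => ?_) fun u v hu hv => ?_
      · rw [LinearMap.smul_apply, ← map_smul, hn r hr, map_zero]
      · rw [LinearMap.add_apply, hu, hv, add_zero]
    have : IsPrecomplete 𝔪 A := inferInstance
    refine finite_of_isHausdorff (𝔪 := 𝔪) ?_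
    let B₀ : Submodule A B := Submodule.torsionBySet A B 𝔪
    let ρ : (B →ₗ[A] E) →ₗ[A] (B₀ →ₗ[A] E) := LinearMap.lcomp A E B₀.subtype
    have hker : LinearMap.ker ρ ≤ 𝔪 • ⊤ := by
      intro g hg
      obtain ⟨m, r, hr⟩ := Submodule.fg_iff_exists_fin_generating_family.1
        (IsNoetherian.noetherian 𝔪)
      let h : B →ₗ[A] (Fin m → B) := LinearMap.pi fun i => r i • LinearMap.id
      have hkg : LinearMap.ker h ≤ LinearMap.ker g := by
        intro x hx
        have hx0 : x ∈ B₀ := by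
          have : 𝔪 ≤ LinearMap.ker (LinearMap.toSpanSingleton A B x) := by
            rw [← hr, Submodule.span_le]
            rintro _ ⟨i, rfl⟩
            exact congrFun (LinearMap.mem_ker.1 hx) i
          exact (Submodule.mem_torsionBySet_iff _ _).2 fun a => by simpa using this a.2
        exact LinearMap.congr_fun (LinearMap.mem_ker.1 hg) ⟨x, hx0⟩
      obtain ⟨ψ, hψ⟩ := hext ((LinearMap.ker h).liftQ h le_rfl)
        (LinearMap.ker_eq_bot.1 (Submodule.ker_liftQ_eq_bot' _ _ rfl))
        ((LinearMap.ker h).liftQ g hkg)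
      have hg' : g = ∑ i, r i • (ψ ∘ₗ LinearMap.single A (fun _ => B) i) := by
        ext x
        have h1 := LinearMap.congr_fun hψ (Submodule.Quotient.mk x)
        simp only [LinearMap.comp_apply, Submodule.liftQ_apply] at h1
        rw [← h1, ← LinearMap.sum_single_apply (φ := fun _ => B) (h x), map_sum]
        simp [h, ← map_smul, ← Pi.single_smul]
      rw [hg']
      refine Submodule.sum_mem _ fun i _ => Submodule.smul_mem_smul ?_ trivial
      rw [← hr]
      exact Submodule.subset_span ⟨i, rfl⟩
    have hB₀ : IsNoetherian A B₀ := by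
      have ht : Module.IsTorsionBySet A B₀ 𝔪 := Submodule.torsionBySet_isTorsionBySet _
      let _ : Module (A ⧸ 𝔪) B₀ := ht.module
      have : IsScalarTower A (A ⧸ 𝔪) B₀ := ht.isScalarTower
      have h1 : IsArtinian (A ⧸ 𝔪) B₀ := isArtinian_of_tower A inferInstance
      have h2 : IsNoetherian (A ⧸ 𝔪) B₀ := IsSemiprimaryRing.isNoetherian_iff_isArtinian.2 h1
      have : Module.Finite (A ⧸ 𝔪) B₀ := inferInstance
      have : Module.Finite A B₀ := Module.Finite.trans (A ⧸ 𝔪) B₀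
      infer_instance
    have hHom : IsNoetherian A (B₀ →ₗ[A] E) := by
      let W := LinearMap.range f
      have : IsNoetherian A W := inferInstance
      refine isNoetherian_of_surjective (LinearMap.compRight A W.subtype)
        (LinearMap.range_eq_top.2 fun g => ⟨g.codRestrict W fun x => ?_, ?_⟩)
      · refine mem_of_essential (𝔪 := 𝔪) hess fun r hr => ?_
        rw [← map_smul, show r • x = 0 from Subtype.ext
          ((Submodule.mem_torsionBySet_iff _ _).1 x.2 ⟨r, hr⟩), map_zero]
      · ext x
        rfl
    have : Module.Finite A ((B →ₗ[A] E) ⧸ LinearMap.ker ρ) :=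
      Module.Finite.equiv ρ.quotKerEquivRange.symm
    exact Module.Finite.of_surjective (Submodule.factor hker) (Submodule.factor_surjective hker)
  · intro B _ _ _ _
    obtain ⟨S, hS⟩ := IsAtomic.exists_atom (Submodule A B)
    have : IsSimpleModule A S := isSimpleModule_iff_isAtom.2 hS
    obtain ⟨Q, hQ, ⟨e⟩⟩ := isSimpleModule_iff_quot_maximal.1 this
    have hQ𝔪 : 𝔪 ≤ Q := h𝔪.trans (sInf_le ⟨bot_le, hQ⟩)
    obtain ⟨N, ⟨e'⟩⟩ := IsSemisimpleModule.exists_submodule_linearEquiv_quotient (R := A)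
      (LinearMap.ker (Submodule.factor hQ𝔪))
    let e'' := (Submodule.factor hQ𝔪).quotKerEquivOfSurjective (Submodule.factor_surjective hQ𝔪)
    let φ : S →ₗ[A] E := f ∘ₗ N.subtype ∘ₗ (e.trans (e'.trans e'').symm).toLinearMap
    have hφ : Function.Injective φ := by
      refine hf.comp (N.injective_subtype.comp (LinearEquiv.injective _))
    obtain ⟨ψ, hψ⟩ := hext S.subtype S.injective_subtype φ
    have hnt : Nontrivial S := IsSimpleModule.nontrivial A S
    obtain ⟨s, hs⟩ := exists_ne (0 : S)
    refine ⟨ψ, 0, fun h => hs (hφ ?_)⟩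
    rw [← hψ, h]
    simp

end Dualizing

section Complete

lemma isNoetherianRing_of_isAdicComplete (R S : Type) [CommRing R] [IsNoetherianRing R] [CommRing S]
    [Algebra R S] (J : Ideal S) (hJ : J.FG) [IsAdicComplete J S]
    (h : Function.Surjective ((Ideal.Quotient.mk J).comp (algebraMap R S))) :
    IsNoetherianRing S := by
  let _ : WithIdeal S := ⟨J⟩
  let _ : UniformSpace R := ⊥
  have : DiscreteTopology R := ⟨rfl⟩
  have hadic : IsAdic J := rfl
  have hc := hadic.isAdicComplete_iff.1 ‹_›
  have := hc.1
  have := hc.2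
  have : IsUniformAddGroup R := inferInstance
  have : IsTopologicalSemiring R := inferInstance
  have : ContinuousSMul R S := ⟨by
    rw [continuous_prod_of_discrete_left]
    intro r
    simp only [Algebra.smul_def]
    exact continuous_const.mul continuous_id⟩
  obtain ⟨n, a, ha⟩ := Submodule.fg_iff_exists_fin_generating_family.1 hJ
  have haJ (i) : a i ∈ J := by
    rw [← ha]
    exact Submodule.subset_span ⟨i, rfl⟩
  have he : MvPowerSeries.HasEval a := by
    refine ⟨fun i => ?_, ?_⟩
    · refine (hadic.hasBasis_nhds_zero.tendsto_right_iff).2 fun k _ => ?_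
      filter_upwards [Filter.eventually_ge_atTop k] with m hm
      exact Ideal.pow_le_pow_right hm (Ideal.pow_mem_pow (haJ i) m)
    · rw [Filter.cofinite_eq_bot]
      exact Filter.tendsto_bot
  let F : MvPowerSeries (Fin n) R →+* S := (MvPowerSeries.aeval (R := R) he).toRingHom
  have hFX (i) : F (MvPowerSeries.X i) = a i := by
    have := MvPowerSeries.aeval_coe (R := R) he (MvPolynomial.X i)
    rw [MvPolynomial.coe_X, MvPolynomial.aeval_X] at this
    exact this
  have hFC (r : R) : F (algebraMap R _ r) = algebraMap R S r :=
    (MvPowerSeries.aeval (R := R) he).commutes r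
  have hmap : (Ideal.span (Set.range (MvPowerSeries.X (R := R) (σ := Fin n)))).map F = J := by
    rw [Ideal.map_span, ← Set.range_comp, ← ha]
    congr 2
    ext i
    exact hFX i
  have hF : Function.Surjective F := by
    refine surjective_of_mk_map_comp_surjective
      (I := Ideal.span (Set.range (MvPowerSeries.X (R := R) (σ := Fin n)))) F (haus := ?_) ?_
    · rw [hmap]
      infer_instance
    · rw [hmap]
      intro y
      obtain ⟨r, hr⟩ := h y
      exact ⟨algebraMap R _ r, by simpa [hFC] using hr⟩
  exact isNoetherianRing_of_surjective _ _ F hF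

end Complete

namespace AdicCompletion
variable {R : Type} [CommRing R] [IsNoetherianRing R] (I : Ideal R)

/-- The extension of the ideal to the completion. -/
noncomputable abbrev idealExt : Ideal (AdicCompletion I R) := I.map (algebraMap R (AdicCompletion I R))

lemma isAdicComplete_idealExt : IsAdicComplete (idealExt I) (AdicCompletion I R) :=
  isAdicComplete_self I (IsNoetherian.noetherian I)

lemma exists_sub_mem (t : AdicCompletion I R) (n : ℕ) :
    ∃ r : R, t - algebraMap R _ r ∈ idealExt I ^ n := by
  obtain ⟨r, hr⟩ := Submodule.Quotient.mk_surjective _ (eval I R n t)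
  refine ⟨r, ?_⟩
  have h : t - algebraMap R _ r ∈ (I ^ n • ⊤ : Submodule R (AdicCompletion I R)) := by
    rw [pow_smul_top_eq_ker_eval (IsNoetherian.noetherian I), LinearMap.mem_ker, map_sub,
      sub_eq_zero, ← hr]
    rfl
  rwa [Ideal.smul_top_eq_map, Ideal.map_pow] at h

instance isNoetherianRing : IsNoetherianRing (AdicCompletion I R) := by
  have := isAdicComplete_idealExt I
  refine isNoetherianRing_of_isAdicComplete R _ (idealExt I)
    (Ideal.FG.map (IsNoetherian.noetherian I) _) fun y => ?_
  obtain ⟨t, rfl⟩ := Ideal.Quotient.mk_surjective y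
  obtain ⟨r, hr⟩ := exists_sub_mem I t 1
  exact ⟨r, (Ideal.Quotient.eq.2 (by simpa using hr)).symm⟩

lemma idealExt_le_of_isMaximal (Q : Ideal (AdicCompletion I R)) (hQ : Q.IsMaximal) :
    idealExt I ≤ Q := by
  have := isAdicComplete_idealExt I
  exact (IsAdicComplete.le_jacobson_bot (idealExt I)).trans (sInf_le ⟨bot_le, hQ⟩)

lemma map_comap_of_idealExt_le {Q : Ideal (AdicCompletion I R)} (hQ : idealExt I ≤ Q) :
    (Q.comap (algebraMap R _)).map (algebraMap R _) = Q := by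
  refine le_antisymm Ideal.map_comap_le fun t ht => ?_
  obtain ⟨r, hr⟩ := exists_sub_mem I t 1
  rw [pow_one] at hr
  have h1 : I ≤ Q.comap (algebraMap R _) := Ideal.map_le_iff_le_comap.1 hQ
  have h2 : algebraMap R _ r ∈ Q := by
    have := Q.sub_mem ht (hQ hr)
    rwa [sub_sub_cancel] at this
  have h3 := add_mem (Ideal.map_mono h1 hr) (Ideal.mem_map_of_mem (algebraMap R _) (show r ∈ Q.comap (algebraMap R _) from h2))
  rwa [sub_add_cancel] at h3

lemma isSemisimpleRing_quotient_idealExt [IsSemisimpleRing (R ⧸ I)] :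
    IsSemisimpleRing (AdicCompletion I R ⧸ idealExt I) := by
  have h := ker_evalOneₐ_eq_map I (IsNoetherian.noetherian I)
  have e := RingHom.quotientKerEquivOfSurjective (f := (evalOneₐ I).toRingHom)
    (evalOneₐ_surjective I)
  exact ((Ideal.quotEquivOfEq h.symm).trans e).symm.isSemisimpleRing

lemma ringKrullDim_quotient_map_le (K : Ideal R) :
    ringKrullDim (AdicCompletion I R ⧸ K.map (algebraMap R (AdicCompletion I R))) ≤
      ringKrullDim (R ⧸ K) := by
  set K' := K.map (algebraMap R (AdicCompletion I R)) with hK'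
  rw [ringKrullDim_le_iff_isMaximal_height_le]
  intro n hn
  let φ : R ⧸ K →+* AdicCompletion I R ⧸ K' :=
    Ideal.quotientMap K' (algebraMap R _) Ideal.le_comap_map
  let _ : Algebra (R ⧸ K) (AdicCompletion I R ⧸ K') := φ.toAlgebra
  let m := n.comap φ
  have : n.LiesOver m := ⟨rfl⟩
  have hmax : (n.comap (Ideal.Quotient.mk K')).IsMaximal :=
    Ideal.comap_isMaximal_of_surjective _ Ideal.Quotient.mk_surjective
  have hnm : m.map φ = n := by
    have h1 := map_comap_of_idealExt_le I (idealExt_le_of_isMaximal I _ hmax)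
    have h2 := congrArg (Ideal.map (Ideal.Quotient.mk K')) h1
    rw [Ideal.map_comap_of_surjective _ Ideal.Quotient.mk_surjective, Ideal.map_map] at h2
    refine le_antisymm Ideal.map_comap_le ?_
    conv_lhs => rw [← h2]
    rw [Ideal.map_le_iff_le_comap]
    intro r hr
    exact Ideal.mem_map_of_mem φ (x := Ideal.Quotient.mk K r) hr
  have h := Ideal.height_le_height_add_of_liesOver m n
  have h0 : (n.map (Ideal.Quotient.mk (m.map (algebraMap (R ⧸ K) (AdicCompletion I R ⧸ K'))))).height = 0 := by
    have : n.map (Ideal.Quotient.mk (m.map (algebraMap (R ⧸ K) (AdicCompletion I R ⧸ K')))) = ⊥ := by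
      rw [Ideal.map_eq_bot_iff_le_ker, Ideal.mk_ker]
      exact hnm.ge
    have hne : Nontrivial ((AdicCompletion I R ⧸ K') ⧸ m.map (algebraMap (R ⧸ K) (AdicCompletion I R ⧸ K'))) := by
      rw [Ideal.Quotient.nontrivial_iff]
      exact fun h => hn.ne_top (hnm ▸ h)
    rw [this]
    exact Ideal.height_bot
  rw [h0, add_zero] at h
  have hm : m.IsPrime := inferInstance
  exact (WithBot.coe_le_coe.2 h).trans (Ideal.height_le_ringKrullDim_of_ne_top hm.ne_top)

lemma coheight_le_of_mem_support {M : Type} [AddCommGroup M] [Module R M] [Module.Finite R M]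
    {d : ℕ} (hd : Order.krullDim (Module.support R M) = d)
    (p : PrimeSpectrum (AdicCompletion I R))
    (hp : p ∈ Module.support (AdicCompletion I R) (AdicCompletion I R ⊗[R] M)) :
    Order.coheight p ≤ d := by
  let T := AdicCompletion I R
  have h1 : Order.krullDim (Module.support T (T ⊗[R] M)) ≤ d := by
    have hK : (Module.annihilator R M).map (algebraMap R T) ≤ Module.annihilator T (T ⊗[R] M) := by
      rw [Ideal.map_le_iff_le_comap]
      intro r hr
      rw [Ideal.mem_comap, Module.mem_annihilator]
      intro x
      rw [algebraMap_smul]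
      induction x with
      | zero => simp
      | tmul t x => rw [← TensorProduct.tmul_smul, Module.mem_annihilator.1 hr, tmul_zero]
      | add x y hx hy => rw [smul_add, hx, hy, add_zero]
    rw [← hd]
    change Module.supportDim T (T ⊗[R] M) ≤ Module.supportDim R M
    rw [Module.supportDim_eq_ringKrullDim_quotient_annihilator,
      Module.supportDim_eq_ringKrullDim_quotient_annihilator]
    exact (ringKrullDim_le_of_surjective (Ideal.Quotient.factor hK)
      (Ideal.Quotient.factor_surjective hK)).trans (ringKrullDim_quotient_map_le I _)
  refine Order.coheight_le fun l hl => ?_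
  have hmem (i) : l i ∈ Module.support T (T ⊗[R] M) := by
    refine Module.mem_support_mono ?_ hp
    rw [← hl]
    exact l.head_le i
  let l' : LTSeries (Module.support T (T ⊗[R] M)) :=
    { length := l.length
      toFun := fun i => ⟨l i, hmem i⟩
      step := fun i => l.step i }
  have h2 := (Order.LTSeries.length_le_krullDim l').trans h1
  exact_mod_cast h2

end AdicCompletion

lemma isSemisimpleRing_quotient_iInf {R : Type} [CommRing R] {P : Set (PrimeSpectrum R)}
    (hP : P.Finite) (h : ∀ p ∈ P, p.asIdeal.IsMaximal) :
    IsSemisimpleRing (R ⧸ ⨅ p ∈ P, p.asIdeal) := by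
  have := hP.to_subtype
  have hm (p : P) : p.1.asIdeal.IsMaximal := h p p.2
  rw [iInf_subtype']
  let _ (p : P) : Field (R ⧸ p.1.asIdeal) := Ideal.Quotient.field _
  exact (Ideal.quotientInfRingEquivPiQuotient (fun p : P => p.1.asIdeal) fun p q hpq =>
    Ideal.isCoprime_of_isMaximal fun h =>
      hpq (Subtype.ext (PrimeSpectrum.ext h))).symm.isSemisimpleRing

section FlatBaseChange
variable {R : Type} [CommRing R] (A : Type) [CommRing A] [Algebra R A] (a : Ideal R)

lemma LC.ev_bijective {N : Type} [AddCommGroup N] [Module R N] {a : Ideal R}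
    (h : a ≤ Module.annihilator R N) : Function.Bijective (LC.ev a N) :=
  ⟨LC.ev_injective, fun _ => LC.exists_ev_eq
    ⟨1, fun r hr => Module.mem_annihilator.1 (h (by simpa using hr)) _⟩⟩

lemma LC.subsingleton_of_le_annihilator [IsNoetherianRing R] {N : Type} [AddCommGroup N]
    [Module R N] {a : Ideal R} (h : a ≤ Module.annihilator R N) (i : ℕ) :
    Subsingleton (LC a (i + 1) N) :=
  LC.subsingleton_of_torsion
    (fun _ => ⟨1, fun _ hr => Module.mem_annihilator.1 (h (by simpa using hr)) _⟩) i

lemma annihilator_le_annihilator_tensorProduct (N : Type) [AddCommGroup N] [Module R N] :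
    Module.annihilator R N ≤ Module.annihilator R (A ⊗[R] N) := by
  intro r hr
  refine Module.mem_annihilator.2 fun z => ?_
  induction z with
  | zero => exact smul_zero _
  | add x y hx hy => rw [smul_add, hx, hy, add_zero]
  | tmul t x => rw [← TensorProduct.tmul_smul, Module.mem_annihilator.1 hr, TensorProduct.tmul_zero]

/-- Local cohomology of a base change. -/
noncomputable def DeltaFun.ofBaseChange [Module.Flat R A] : DeltaFun R where
  obj i N _ _ := LC a i (A ⊗[R] N)
  acg i N _ _ := inferInstance
  mod i N _ _ := inferInstance
  map i _ _ _ _ _ _ f := LC.map a i (f.lTensor A)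
  map_smul_id i N _ _ r x := by
    rw [LinearMap.lTensor_smul, LinearMap.lTensor_id, LC.map_smul, LC.map_id]
  map_comp i _ _ _ _ _ _ _ _ _ f g x := by
    rw [LinearMap.lTensor_comp, LC.map_comp]
  δ i _ _ _ _ _ _ _ _ _ f g hf hg h :=
    LC.δ a i (Module.Flat.lTensor_preserves_injective_linearMap f hf)
      (LinearMap.lTensor_surjective A hg) (lTensor_exact A h hg)
  map_zero_injective hf :=
    LC.map_zero_injective (Module.Flat.lTensor_preserves_injective_linearMap _ hf)
  exact_map _ _ _ _ _ _ _ _ _ _ _ _ hf hg h :=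
    LC.exact_map (Module.Flat.lTensor_preserves_injective_linearMap _ hf)
      (LinearMap.lTensor_surjective A hg) (lTensor_exact A h hg)
  exact_map_δ _ _ _ _ _ _ _ _ _ _ _ _ _ _ _ := LC.exact_map_δ _ _ _
  exact_δ_map _ _ _ _ _ _ _ _ _ _ _ _ _ _ _ := LC.exact_δ_map _ _ _

/-- The base change of local cohomology. -/
noncomputable def DeltaFun.tensor [Module.Flat R A] : DeltaFun R where
  obj i N _ _ := A ⊗[R] LC a i N
  acg i N _ _ := inferInstance
  mod i N _ _ := inferInstance
  map i _ _ _ _ _ _ f := (LC.map a i f).lTensor A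
  map_smul_id i N _ _ r x := by
    have : LC.map a i (r • LinearMap.id : N →ₗ[R] N) = r • LinearMap.id :=
      LinearMap.ext fun x => by rw [LC.map_smul, LC.map_id]; rfl
    rw [this, LinearMap.lTensor_smul, LinearMap.lTensor_id]
    rfl
  map_comp i _ _ _ _ _ _ _ _ _ f g x := by
    have : LC.map a i (g ∘ₗ f) = LC.map a i g ∘ₗ LC.map a i f :=
      LinearMap.ext fun x => LC.map_comp _ _ _
    rw [this, LinearMap.lTensor_comp]
    rfl
  δ i _ _ _ _ _ _ _ _ _ f g hf hg h := (LC.δ a i hf hg h).lTensor A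
  map_zero_injective hf :=
    Module.Flat.lTensor_preserves_injective_linearMap _ (LC.map_zero_injective hf)
  exact_map _ _ _ _ _ _ _ _ _ _ _ _ hf hg h := Module.Flat.lTensor_exact A (LC.exact_map hf hg h)
  exact_map_δ _ _ _ _ _ _ _ _ _ _ _ _ _ _ _ := Module.Flat.lTensor_exact A (LC.exact_map_δ _ _ _)
  exact_δ_map _ _ _ _ _ _ _ _ _ _ _ _ _ _ _ := Module.Flat.lTensor_exact A (LC.exact_δ_map _ _ _)

/-- The comparison map of flat base change. -/
noncomputable def LC.baseChange (i : ℕ) (N : Type) [AddCommGroup N] [Module R N] :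
    A ⊗[R] LC a i N →ₗ[R] LC a i (A ⊗[R] N) :=
  TensorProduct.lift (LinearMap.mk₂ R (fun t x => LC.map a i (TensorProduct.mk R A N t) x)
    (fun t s x => by rw [_root_.map_add, LC.map_add])
    (fun r t x => by rw [_root_.map_smul, LC.map_smul])
    (fun t x y => _root_.map_add _ _ _) (fun r t x => _root_.map_smul _ _ _))

@[simp] lemma LC.baseChange_tmul (i : ℕ) (N : Type) [AddCommGroup N] [Module R N] (t : A)
    (x : LC a i N) :
    LC.baseChange A a i N (t ⊗ₜ x) = LC.map a i (TensorProduct.mk R A N t) x := rfl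

/-- The comparison of the base change of local cohomology with local cohomology of base changes. -/
noncomputable def DeltaHom.baseChange [Module.Flat R A] :
    DeltaHom (DeltaFun.tensor A a) (DeltaFun.ofBaseChange A a) where
  app i N _ _ := LC.baseChange A a i N
  map i N N' _ _ _ _ f x := by
    change A ⊗[R] LC a i N at x
    change LC.baseChange A a i N' ((LC.map a i f).lTensor A x) =
      LC.map a i (f.lTensor A) (LC.baseChange A a i N x)
    induction x with
    | zero => simp only [map_zero]
    | add x y hx hy => simp only [map_add, hx, hy]
    | tmul t x =>
      rw [LinearMap.lTensor_tmul, LC.baseChange_tmul, LC.baseChange_tmul, ← LC.map_comp,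
        ← LC.map_comp]
      rfl
  δ i N N' N'' _ _ _ _ _ _ f g hf hg h x := by
    change A ⊗[R] LC a i N'' at x
    change LC.baseChange A a (i + 1) N ((LC.δ a i hf hg h).lTensor A x) =
      LC.δ a i (Module.Flat.lTensor_preserves_injective_linearMap f hf)
        (LinearMap.lTensor_surjective A hg) (lTensor_exact A h hg) (LC.baseChange A a i N'' x)
    induction x with
    | zero => simp only [map_zero]
    | add x y hx hy => simp only [map_add, hx, hy]
    | tmul t x =>
      rw [LinearMap.lTensor_tmul, LC.baseChange_tmul, LC.baseChange_tmul]
      exact LC.δ_naturality hf hg h _ _ _ (TensorProduct.mk R A N t) (TensorProduct.mk R A N' t)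
        (TensorProduct.mk R A N'' t) rfl rfl x

/-- Local cohomology commutes with flat base change. -/
theorem LC.bijective_baseChange [IsNoetherianRing R] [Module.Flat R A] (i : ℕ)
    (N : Type) [AddCommGroup N] [Module R N] [Module.Finite R N] :
    Function.Bijective (LC.baseChange A a i N) := by
  refine (DeltaHom.baseChange A a).bijective (I := ⊥) (J := a) ?_ ?_ ?_ N bot_le i
  · intro i N _ _ x y hy
    change A ⊗[R] LC a i N at x
    change ∃ n : ℕ, y ^ n • (x : A ⊗[R] LC a i N) = 0
    induction x with
    | zero => exact ⟨0, smul_zero _⟩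
    | add x z hx hz =>
      obtain ⟨m, hm⟩ := hx
      obtain ⟨n, hn⟩ := hz
      refine ⟨m + n, ?_⟩
      rw [smul_add, pow_add, mul_smul (y ^ m) (y ^ n) z, hn, mul_comm, mul_smul, hm, smul_zero,
        smul_zero, add_zero]
    | tmul t x =>
      obtain ⟨n, hn⟩ := LC.exists_pow_smul_eq_zero_of_mem x hy
      exact ⟨n, by rw [← TensorProduct.tmul_smul, hn, TensorProduct.tmul_zero]⟩
  · exact fun i N _ _ x y hy => LC.exists_pow_smul_eq_zero_of_mem (N := A ⊗[R] N) x hy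
  · intro q _ hq i
    have h1 : a ≤ Module.annihilator R (R ⧸ q.asIdeal) := by rwa [Ideal.annihilator_quotient]
    have h2 := h1.trans (annihilator_le_annihilator_tensorProduct A (R ⧸ q.asIdeal))
    change Function.Bijective (LC.baseChange A a i (R ⧸ q.asIdeal))
    cases i with
    | zero =>
      have h3 : ⇑(LC.ev a _) ∘ ⇑(LC.baseChange A a 0 (R ⧸ q.asIdeal)) =
          (LC.ev a (R ⧸ q.asIdeal)).lTensor A := by
        funext x
        rw [Function.comp_apply]
        induction x with
        | zero => simp only [map_zero]
        | add x y hx hy => simp only [_root_.map_add, hx, hy]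
        | tmul t x => rw [LC.baseChange_tmul, LC.ev_map]; rfl
      have h4 : Function.Bijective ((LC.ev a (R ⧸ q.asIdeal)).lTensor A) :=
        ((LinearEquiv.ofBijective _ (LC.ev_bijective h1)).lTensor A).bijective
      rw [← h3] at h4
      exact (Function.Bijective.of_comp_iff' (LC.ev_bijective h2) _).1 h4
    | succ i =>
      have := LC.subsingleton_of_le_annihilator h1 i
      have := LC.subsingleton_of_le_annihilator h2 i
      exact ⟨Function.injective_of_subsingleton _, Function.surjective_to_subsingleton _⟩

end FlatBaseChange

section RestrictedLocalCohomology
variable {R : Type} [CommRing R] (A : Type) [CommRing A] [Algebra R A] (a : Ideal R) (i : ℕ)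

/-- A module over an algebra, regarded as a module over the base ring. -/
def Restricted (_R _A N : Type) : Type := N

instance (R A N : Type) [AddCommGroup N] : AddCommGroup (Restricted R A N) :=
  inferInstanceAs (AddCommGroup N)

instance (R A N : Type) [CommRing R] [CommRing A] [Algebra R A] [AddCommGroup N] [Module A N] :
    Module R (Restricted R A N) :=
  inferInstanceAs (Module R (RestrictScalars R A N))

section restrictMap
variable {A} {N N' N'' : Type} [AddCommGroup N] [Module A N] [AddCommGroup N'] [Module A N']
  [AddCommGroup N''] [Module A N'']

variable (R) in
/-- A linear map, regarded as a map of modules over the base ring. -/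
def restrictMap (f : N →ₗ[A] N') : Restricted R A N →ₗ[R] Restricted R A N' where
  toFun := f
  map_add' := map_add f
  map_smul' r x := map_smul f (algebraMap R A r) (show N from x)

lemma restrictMap_injective {f : N →ₗ[A] N'} (hf : Function.Injective f) :
    Function.Injective (restrictMap R f) := hf

lemma restrictMap_surjective {f : N →ₗ[A] N'} (hf : Function.Surjective f) :
    Function.Surjective (restrictMap R f) := hf

lemma restrictMap_exact {f : N →ₗ[A] N'} {g : N' →ₗ[A] N''} (h : Function.Exact f g) :
    Function.Exact (restrictMap R f) (restrictMap R g) := h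

end restrictMap

/-- Local cohomology with respect to an ideal of the base ring, as a module over the
algebra. -/
def RestrictedLC (N : Type) [AddCommGroup N] [Module A N] : Type := LC a i (Restricted R A N)

variable (N : Type) [AddCommGroup N] [Module A N] {N' N'' : Type} [AddCommGroup N'] [Module A N']
  [AddCommGroup N''] [Module A N'']

noncomputable instance : AddCommGroup (RestrictedLC A a i N) :=
  inferInstanceAs (AddCommGroup (LC a i (Restricted R A N)))

noncomputable instance RestrictedLC.moduleBase : Module R (RestrictedLC A a i N) :=
  inferInstanceAs (Module R (LC a i (Restricted R A N)))

/-- The action of a scalar on restricted local cohomology. -/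
noncomputable def RestrictedLC.smulMap (t : A) :
    RestrictedLC A a i N →ₗ[R] RestrictedLC A a i N :=
  LC.map a i (restrictMap R (t • LinearMap.id : N →ₗ[A] N))

noncomputable instance RestrictedLC.module : Module A (RestrictedLC A a i N) where
  smul t x := RestrictedLC.smulMap A a i N t x
  one_smul x := by
    change LC a i (Restricted R A N) at x
    change LC.map a i (restrictMap R ((1 : A) • LinearMap.id : N →ₗ[A] N)) x = x
    rw [one_smul]
    exact LC.map_id x
  mul_smul s t x := by
    change LC a i (Restricted R A N) at x
    change LC.map a i (restrictMap R ((s * t) • LinearMap.id : N →ₗ[A] N)) x =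
      LC.map a i _ (LC.map a i _ x)
    rw [← LC.map_comp]
    congr 2
    exact LinearMap.ext fun y => mul_smul s t (show N from y)
  smul_zero t := map_zero (RestrictedLC.smulMap A a i N t)
  smul_add t := map_add (RestrictedLC.smulMap A a i N t)
  add_smul s t x := by
    change LC a i (Restricted R A N) at x
    change LC.map a i (restrictMap R ((s + t) • LinearMap.id : N →ₗ[A] N)) x =
      LC.map a i _ x + LC.map a i _ x
    have h : restrictMap R ((s + t) • LinearMap.id : N →ₗ[A] N) =
        restrictMap R (s • LinearMap.id) + restrictMap R (t • LinearMap.id) :=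
      LinearMap.ext fun y => add_smul s t (show N from y)
    exact (congrArg (fun f => LC.map a i f x) h).trans (LC.map_add _ _ x)
  zero_smul x := by
    change LC a i (Restricted R A N) at x
    change LC.map a i (restrictMap R ((0 : A) • LinearMap.id : N →ₗ[A] N)) x =
      (0 : LC a i (Restricted R A N))
    have h : restrictMap R ((0 : A) • LinearMap.id : N →ₗ[A] N) = (0 : R) • LinearMap.id :=
      LinearMap.ext fun y => (zero_smul A (show N from y)).trans (zero_smul R y).symm
    rw [h, LC.map_smul, zero_smul]

namespace RestrictedLC
variable {A N}

lemma smul_def (t : A) (x : RestrictedLC A a i N) : t • x =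
    (LC.map a i (restrictMap R (t • LinearMap.id : N →ₗ[A] N)) (show LC a i _ from x) :
      LC a i _) := rfl

lemma algebraMap_smul' (r : R) (x : RestrictedLC A a i N) : algebraMap R A r • x = r • x := by
  have h : restrictMap R (algebraMap R A r • LinearMap.id : N →ₗ[A] N) = r • LinearMap.id := rfl
  rw [smul_def, h]
  exact (LC.map_smul _ _ _).trans (congrArg _ (LC.map_id _))

/-- Functoriality in the module. -/
noncomputable def map (f : N →ₗ[A] N') : RestrictedLC A a i N →ₗ[A] RestrictedLC A a i N' where
  toFun := LC.map a i (restrictMap R f)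
  map_add' := map_add (LC.map a i (restrictMap R f))
  map_smul' t x := by
    change LC a i (Restricted R A N) at x
    change LC.map a i _ (LC.map a i _ x) = LC.map a i _ (LC.map a i _ x)
    rw [← LC.map_comp, ← LC.map_comp]
    congr 2
    exact LinearMap.ext fun y => map_smul f t (show N from y)

/-- The connecting homomorphism. -/
noncomputable def δ {f : N →ₗ[A] N'} {g : N' →ₗ[A] N''} (hf : Function.Injective f)
    (hg : Function.Surjective g) (h : Function.Exact f g) :
    RestrictedLC A a i N'' →ₗ[A] RestrictedLC A a (i + 1) N where
  toFun := LC.δ a i (restrictMap_injective hf) (restrictMap_surjective hg) (restrictMap_exact h)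
  map_add' := map_add (LC.δ a i (restrictMap_injective hf) (restrictMap_surjective hg)
    (restrictMap_exact h))
  map_smul' t x := (LC.δ_naturality (R := R) _ _ _ (restrictMap_injective hf)
    (restrictMap_surjective hg) (restrictMap_exact h) (restrictMap R (t • LinearMap.id))
    (restrictMap R (t • LinearMap.id)) (restrictMap R (t • LinearMap.id))
    (LinearMap.ext fun y => (map_smul f t (show N from y)).symm)
    (LinearMap.ext fun y => (map_smul g t (show N' from y)).symm) x).symm

variable {c : Ideal R} in
/-- Comparison map for an inclusion of ideals. -/
noncomputable def res (hac : a ≤ c) : RestrictedLC A c i N →ₗ[A] RestrictedLC A a i N where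
  toFun := LC.res i _ hac
  map_add' := map_add (LC.res i _ hac)
  map_smul' t x := LC.res_map hac (restrictMap R (t • LinearMap.id : N →ₗ[A] N)) x

end RestrictedLC

/-- Local cohomology with respect to an ideal of the base ring, on modules over an algebra. -/
noncomputable def DeltaFun.restricted : DeltaFun A where
  obj i N _ _ := RestrictedLC A a i N
  acg _ _ _ _ := inferInstance
  mod i N _ _ := RestrictedLC.module A a i N
  map i _ _ _ _ _ _ f := RestrictedLC.map a i f
  map_smul_id _ _ _ _ _ _ := rfl
  map_comp _ _ _ _ _ _ _ _ _ _ f g x :=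
    LC.map_comp (restrictMap R f) (restrictMap R g) x
  δ i _ _ _ _ _ _ _ _ _ _ _ hf hg h := RestrictedLC.δ a i hf hg h
  map_zero_injective hf := LC.map_zero_injective (restrictMap_injective hf)
  exact_map i _ _ _ _ _ _ _ _ _ f g hf hg h := LC.exact_map (a := a) (i := i)
    (f := restrictMap R f) (g := restrictMap R g) (restrictMap_injective hf)
    (restrictMap_surjective hg) (restrictMap_exact h)
  exact_map_δ i _ _ _ _ _ _ _ _ _ f g hf hg h := LC.exact_map_δ (a := a) (i := i)
    (f := restrictMap R f) (g := restrictMap R g) (restrictMap_injective hf)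
    (restrictMap_surjective hg) (restrictMap_exact h)
  exact_δ_map i _ _ _ _ _ _ _ _ _ f g hf hg h := LC.exact_δ_map (a := a) (i := i)
    (f := restrictMap R f) (g := restrictMap R g) (restrictMap_injective hf)
    (restrictMap_surjective hg) (restrictMap_exact h)

/-- The comparison morphism for an inclusion of ideals. -/
noncomputable def DeltaHom.restricted {a c : Ideal R} (hac : a ≤ c) :
    DeltaHom (DeltaFun.restricted A c) (DeltaFun.restricted A a) where
  app i _ _ _ := RestrictedLC.res a i hac
  map _ _ _ _ _ _ _ f x := LC.res_map hac (restrictMap R f) x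
  δ _ _ _ _ _ _ _ _ _ _ _ _ hf hg h x := LC.res_δ hac (restrictMap_injective hf)
    (restrictMap_surjective hg) (restrictMap_exact h) x

variable {A}

lemma le_annihilator_restricted {a : Ideal R}
    (h : a.map (algebraMap R A) ≤ Module.annihilator A N) :
    a ≤ Module.annihilator R (Restricted R A N) := fun _ hr =>
  Module.mem_annihilator.2 fun x =>
    Module.mem_annihilator.1 (h (Ideal.mem_map_of_mem _ hr)) (show N from x)

/-- The inclusion of degree zero restricted local cohomology. -/
noncomputable def RestrictedLC.ev : RestrictedLC A a 0 N →ₗ[A] N where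
  toFun := LC.ev a (Restricted R A N)
  map_add' := map_add (LC.ev a (Restricted R A N))
  map_smul' t x := LC.ev_map (restrictMap R (t • LinearMap.id : N →ₗ[A] N)) x

variable (A) in
lemma DeltaFun.isSupported_restricted [IsNoetherianRing R] :
    (DeltaFun.restricted A a).IsSupported (a.map (algebraMap R A)) where
  torsion i N _ _ x y hy := by
    change RestrictedLC A a i N at x
    change ∃ n : ℕ, y ^ n • (x : RestrictedLC A a i N) = 0
    obtain ⟨n, hn⟩ := LC.exists_pow_smul_eq_zero (show LC a i (Restricted R A N) from x)
    refine ⟨n, ?_⟩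
    have := Ideal.pow_mem_pow hy n
    rw [← Ideal.map_pow] at this
    generalize y ^ n = s at this
    induction this using Submodule.span_induction with
    | mem s hs =>
      obtain ⟨r, hr, rfl⟩ := hs
      exact (RestrictedLC.algebraMap_smul' a i r x).trans (hn r hr)
    | zero => exact zero_smul _ _
    | add s t _ _ hs ht => rw [add_smul, hs, ht, add_zero]
    | smul c s _ hs => rw [smul_eq_mul, mul_smul, hs, smul_zero]
  vanish i N _ _ h := LC.subsingleton_of_le_annihilator (le_annihilator_restricted N h) i
  artinian_zero N _ _ _ := isArtinian_of_injective (RestrictedLC.ev (A := A) a N)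
    (LC.ev_injective (a := a) (N := Restricted R A N))

lemma DeltaHom.bijective_restricted [IsNoetherianRing R] {a c : Ideal R} (hac : a ≤ c)
    {N : Type} [AddCommGroup N] [Module A N]
    (h : c.map (algebraMap R A) ≤ Module.annihilator A N) (i : ℕ) :
    Function.Bijective ((DeltaHom.restricted A hac).app i N) := by
  have hc := le_annihilator_restricted N h
  change Function.Bijective (LC.res i (Restricted R A N) hac)
  cases i with
  | zero =>
    refine (Function.Bijective.of_comp_iff' (LC.ev_bijective (hac.trans hc)) _).1 ?_
    convert LC.ev_bijective hc
    exact funext fun x => LC.ev_res hac x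
  | succ i =>
    have := LC.subsingleton_of_le_annihilator hc i
    have := LC.subsingleton_of_le_annihilator (hac.trans hc) i
    exact ⟨Function.injective_of_subsingleton _, Function.surjective_to_subsingleton _⟩

end RestrictedLocalCohomology

section TorsionOverCompletion
namespace AdicCompletion
variable {R : Type} [CommRing R] {I : Ideal R}

lemma smul_eq_zero_of_mem {X : Type} [AddCommGroup X] [Module R X] [Module (AdicCompletion I R) X]
    [IsScalarTower R (AdicCompletion I R) X] {x : X} {n : ℕ} (hx : ∀ r ∈ I ^ n, r • x = 0)
    {s : AdicCompletion I R} (hs : s ∈ idealExt I ^ n) : s • x = 0 := by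
  rw [idealExt, ← Ideal.map_pow] at hs
  induction hs using Submodule.span_induction with
  | mem s hs =>
    obtain ⟨r, hr, rfl⟩ := hs
    exact (algebraMap_smul _ r x).trans (hx r hr)
  | zero => exact zero_smul _ _
  | add s t _ _ hs ht => rw [add_smul, hs, ht, add_zero]
  | smul c s _ hs => rw [smul_eq_mul, mul_smul, hs, smul_zero]

variable [IsNoetherianRing R]

/-- Every scalar of the completion acts on a torsion element as a scalar of the base ring. -/
lemma exists_smul_eq (t : AdicCompletion I R) (n : ℕ) :
    ∃ r : R, ∀ (X : Type) [AddCommGroup X] [Module R X] [Module (AdicCompletion I R) X]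
      [IsScalarTower R (AdicCompletion I R) X] (x : X), (∀ r ∈ I ^ n, r • x = 0) →
      t • x = r • x := by
  obtain ⟨r, hr⟩ := exists_sub_mem I t n
  refine ⟨r, fun X _ _ _ _ x hx => ?_⟩
  have := smul_eq_zero_of_mem hx hr
  rwa [sub_smul, sub_eq_zero, algebraMap_smul] at this

variable {X Y : Type} [AddCommGroup X] [Module R X] [Module (AdicCompletion I R) X]
    [IsScalarTower R (AdicCompletion I R) X] [AddCommGroup Y] [Module R Y]
    [Module (AdicCompletion I R) Y] [IsScalarTower R (AdicCompletion I R) Y]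

/-- Linear equivalences of torsion modules are linear over the completion. -/
noncomputable def extendEquiv (hX : ∀ x : X, ∃ n, ∀ r ∈ I ^ n, r • x = 0) (e : X ≃ₗ[R] Y) :
    X ≃ₗ[AdicCompletion I R] Y :=
  { e with
    map_smul' := fun t x => by
      obtain ⟨n, hn⟩ := hX x
      obtain ⟨r, hr⟩ := exists_smul_eq t n
      change e (t • x) = t • e x
      rw [hr X x hn, hr Y (e x) fun s hs => by rw [← map_smul, hn s hs, _root_.map_zero], map_smul] }

variable (I) in
/-- Extending scalars to the completion does not change a torsion module. -/
lemma bijective_tmul_one (hX : ∀ x : X, ∃ n, ∀ r ∈ I ^ n, r • x = 0) :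
    Function.Bijective (TensorProduct.mk R (AdicCompletion I R) X 1) := by
  have hl (x : X) : LinearMap.liftBaseChange (AdicCompletion I R) (LinearMap.id : X →ₗ[R] X)
      (TensorProduct.mk R (AdicCompletion I R) X 1 x) = x := by
    simp
  refine ⟨Function.LeftInverse.injective hl, fun z => ?_⟩
  induction z with
  | zero => exact ⟨0, _root_.map_zero _⟩
  | add y z hy hz =>
    obtain ⟨y, rfl⟩ := hy
    obtain ⟨z, rfl⟩ := hz
    exact ⟨y + z, map_add _ _ _⟩
  | tmul t x =>
    obtain ⟨n, hn⟩ := hX x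
    obtain ⟨r, hr⟩ := exists_smul_eq t n
    refine ⟨r • x, ?_⟩
    have := hr (AdicCompletion I R ⊗[R] X) (1 ⊗ₜ x) fun s hs => by
      rw [← TensorProduct.tmul_smul, hn s hs, TensorProduct.tmul_zero]
    rw [TensorProduct.smul_tmul', smul_eq_mul, mul_one] at this
    rw [this, map_smul]
    rfl

end AdicCompletion

/-- A module supported on a finite set of primes is torsion for their intersection. -/
lemma exists_pow_smul_eq_zero_of_support {R : Type} [CommRing R] [IsNoetherianRing R]
    {X : Type} [AddCommGroup X] [Module R X] {P : Set (PrimeSpectrum R)}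
    (hP : Module.support R X = P) (x : X) :
    ∃ n, ∀ r ∈ (⨅ p ∈ P, p.asIdeal) ^ n, r • x = 0 := by
  have h : (⨅ p ∈ P, p.asIdeal) ≤ (Submodule.span R {x}).annihilator.radical := by
    rw [Ideal.radical_eq_sInf]
    refine le_sInf fun p ⟨hp, hp'⟩ => ?_
    have : (⟨p, hp'⟩ : PrimeSpectrum R) ∈ P := by
      rw [← hP, Module.mem_support_iff_exists_annihilator]
      exact ⟨x, hp⟩
    exact iInf₂_le (⟨p, hp'⟩ : PrimeSpectrum R) this
  obtain ⟨n, hn⟩ := Ideal.exists_pow_le_of_le_radical_of_fg h (IsNoetherian.noetherian _)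
  exact ⟨n, fun r hr => (Submodule.mem_annihilator_span_singleton _ _).1 (hn hr)⟩

/-- An ideal whose elements act nilpotently lies in every prime of the support. -/
lemma le_iInf_of_support {R : Type} [CommRing R]
    {X : Type} [AddCommGroup X] [Module R X] {P : Set (PrimeSpectrum R)}
    (hP : Module.support R X = P) {a : Ideal R} (ha : ∀ x : X, ∃ n, ∀ r ∈ a ^ n, r • x = 0) :
    a ≤ ⨅ p ∈ P, p.asIdeal := by
  refine le_iInf₂ fun p hp => ?_
  rw [← hP, Module.mem_support_iff_exists_annihilator] at hp
  obtain ⟨x, hx⟩ := hp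
  obtain ⟨n, hn⟩ := ha x
  exact p.2.le_of_pow_le (n := n) fun r hr =>
    hx ((Submodule.mem_annihilator_span_singleton _ _).2 (hn r hr))

lemma attachedPrimes_subset_of_equiv {A : Type} [CommRing A] {X Y : Type} [AddCommGroup X]
    [Module A X] [AddCommGroup Y] [Module A Y] (e : X ≃ₗ[A] Y) :
    AttachedPrimes A X ⊆ AttachedPrimes A Y := by
  rintro p ⟨n, S, ⟨h1, h2, h3, h4⟩, i, rfl⟩
  have ha (i) : ((S i).map e.toLinearMap).annihilator = (S i).annihilator :=
    ((e.submoduleMap (S i)).annihilator_eq).symm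
  refine ⟨n, fun i => (S i).map e.toLinearMap, ⟨fun i => ⟨?_, fun r => ?_⟩, ?_, ?_, fun j hj => ?_⟩,
    i, by rw [ha]⟩
  · rw [Ne, Submodule.map_eq_bot_iff]
    exact (h1 i).1
  · refine ((h1 i).2 r).imp ?_ ?_
    · rintro h _ ⟨m, hm, rfl⟩
      obtain ⟨s, hs, rfl⟩ := h m hm
      exact ⟨e s, ⟨s, hs, rfl⟩, (map_smul _ _ _).symm⟩
    · rintro ⟨n, h⟩
      refine ⟨n, ?_⟩
      rintro _ ⟨m, hm, rfl⟩
      rw [← map_smul, h m hm, _root_.map_zero]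
  · rw [← Submodule.map_iSup, h2, Submodule.map_top, LinearEquiv.range]
  · simpa only [ha] using h3
  · refine h4 j ?_
    simp only [← Submodule.map_iSup] at hj
    exact (Submodule.map_le_map_iff_of_injective e.injective _ _).1 hj

lemma attachedPrimes_eq_of_equiv {A : Type} [CommRing A] {X Y : Type} [AddCommGroup X]
    [Module A X] [AddCommGroup Y] [Module A Y] (e : X ≃ₗ[A] Y) :
    AttachedPrimes A X = AttachedPrimes A Y :=
  (attachedPrimes_subset_of_equiv e).antisymm (attachedPrimes_subset_of_equiv e.symm)

end TorsionOverCompletion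

section Comparison
variable {R : Type} [CommRing R]

/-- Functoriality of local cohomology in equivalences. -/
noncomputable def LC.congr (a : Ideal R) (i : ℕ) {N N' : Type} [AddCommGroup N] [Module R N]
    [AddCommGroup N'] [Module R N'] (e : N ≃ₗ[R] N') : LC a i N ≃ₗ[R] LC a i N' :=
  LinearEquiv.ofLinearMap (LC.map a i e.toLinearMap) (LC.map a i e.symm.toLinearMap)
    (LinearMap.ext fun x => by
      rw [LinearMap.comp_apply, ← LC.map_comp, LinearEquiv.comp_symm, LC.map_id]; rfl)
    (LinearMap.ext fun x => by
      rw [LinearMap.comp_apply, ← LC.map_comp, LinearEquiv.symm_comp, LC.map_id]; rfl)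

/-- The identity, from a module over an algebra to its restriction. -/
def restrictedEquiv (A N : Type) [CommRing A] [Algebra R A] [AddCommGroup N] [Module A N]
    [Module R N] [IsScalarTower R A N] : N ≃ₗ[R] Restricted R A N where
  toFun x := x
  invFun x := x
  map_add' _ _ := rfl
  map_smul' r x := (algebraMap_smul A r x).symm
  left_inv _ := rfl
  right_inv _ := rfl

/-- Torsion local cohomology is unchanged by completion of the module. -/
noncomputable def TopLC.completionEquiv [IsNoetherianRing R] {I : Ideal R} {M : Type}
    [AddCommGroup M] [Module R M] [Module.Finite R M] {a : Ideal R} {i : ℕ}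
    [Module (AdicCompletion I R) (TopLC R a i M)]
    [IsScalarTower R (AdicCompletion I R) (TopLC R a i M)]
    (h : ∀ x : TopLC R a i M, ∃ n, ∀ r ∈ I ^ n, r • x = 0) :
    TopLC R a i M ≃ₗ[AdicCompletion I R]
      RestrictedLC (AdicCompletion I R) a i (AdicCompletion I R ⊗[R] M) :=
  have := AdicCompletion.flat_of_isNoetherian I
  have : IsScalarTower R (AdicCompletion I R)
      (RestrictedLC (AdicCompletion I R) a i (AdicCompletion I R ⊗[R] M)) :=
    ⟨fun r t x => by rw [Algebra.smul_def, mul_smul, RestrictedLC.algebraMap_smul']⟩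
  AdicCompletion.extendEquiv h
    ((LinearEquiv.ofBijective _ (AdicCompletion.bijective_tmul_one I h)).trans
      (((show TopLC R a i M ≃ₗ[R] LC a i M from localCohomologyEquiv a i M).lTensor
        (AdicCompletion I R)).trans
        ((LinearEquiv.ofBijective _ (LC.bijective_baseChange (AdicCompletion I R) a i M)).trans
          (show LC a i (AdicCompletion I R ⊗[R] M) ≃ₗ[R]
              RestrictedLC (AdicCompletion I R) a i (AdicCompletion I R ⊗[R] M) from
            LC.congr a i (restrictedEquiv (AdicCompletion I R) (AdicCompletion I R ⊗[R] M))))))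

lemma TopLC.exists_pow_smul_eq_zero {M : Type} [AddCommGroup M] [Module R M] {a : Ideal R}
    {i : ℕ} (x : TopLC R a i M) : ∃ n, ∀ r ∈ a ^ n, r • x = 0 := by
  let e : TopLC R a i M ≃ₗ[R] LC a i M := localCohomologyEquiv a i M
  obtain ⟨n, hn⟩ := LC.exists_pow_smul_eq_zero (e x)
  exact ⟨n, fun r hr => e.injective (by rw [map_smul, hn r hr, map_zero])⟩

end Comparison

/-- With `P` a finite set of maximal ideals, `𝔐 = ∩_{m ∈ P} m`, `T` the
`𝔐`-adic completion of `R`, and ideals `a`, `b` with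
`Supp_R H^d_a(M) = Supp_R H^d_b(M) = P`: if `a ⊆ b` or
`Att_T H^d_a(M) ⊆ Att_T H^d_b(M)` (for the natural `T`-module structures, i.e. the ones
compatible with the `R`-actions), then `H^d_a(M)` is a quotient of `H^d_b(M)`. -/
theorem stmt_16 (R : Type) [CommRing R] [IsNoetherianRing R]
    (M : Type) [AddCommGroup M] [Module R M] [Module.Finite R M]
    (d : ℕ) (hd : moduleDim R M = (d : WithBot ℕ∞))
    (P : Set (PrimeSpectrum R)) (hPfin : P.Finite) (hPmax : ∀ p ∈ P, p.asIdeal.IsMaximal)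
    (𝔐 : Ideal R) (h𝔐 : 𝔐 = ⨅ p ∈ P, p.asIdeal)
    (a b : Ideal R)
    (hsa : Module.support R (TopLC R a d M) = P)
    (hsb : Module.support R (TopLC R b d M) = P)
    (sa : Module (AdicCompletion 𝔐 R) (TopLC R a d M))
    (sb : Module (AdicCompletion 𝔐 R) (TopLC R b d M))
    (hta : ∀ (r : R) (x : TopLC R a d M),
      (letI := sa; (algebraMap R (AdicCompletion 𝔐 R) r) • x) = r • x)
    (htb : ∀ (r : R) (x : TopLC R b d M),
      (letI := sb; (algebraMap R (AdicCompletion 𝔐 R) r) • x) = r • x)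
    (hcase : a ≤ b ∨
      @AttachedPrimes (AdicCompletion 𝔐 R) _ (TopLC R a d M) _ sa ⊆
        @AttachedPrimes (AdicCompletion 𝔐 R) _ (TopLC R b d M) _ sb) :
    ∃ N : Submodule R (TopLC R b d M),
      Nonempty ((TopLC R a d M) ≃ₗ[R] ((TopLC R b d M) ⧸ N)) := by
  have towa : IsScalarTower R (AdicCompletion 𝔐 R) (TopLC R a d M) :=
    ⟨fun r t x => by rw [Algebra.smul_def, mul_smul, hta]⟩
  have towb : IsScalarTower R (AdicCompletion 𝔐 R) (TopLC R b d M) :=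
    ⟨fun r t x => by rw [Algebra.smul_def, mul_smul, htb]⟩
  have ta := exists_pow_smul_eq_zero_of_support hsa
  have tb := exists_pow_smul_eq_zero_of_support hsb
  have ha := le_iInf_of_support hsa TopLC.exists_pow_smul_eq_zero
  have hb := le_iInf_of_support hsb TopLC.exists_pow_smul_eq_zero
  have hss := isSemisimpleRing_quotient_iInf hPfin hPmax
  rw [← h𝔐] at ta tb ha hb hss
  let ea := TopLC.completionEquiv ta
  let eb := TopLC.completionEquiv tb
  have := AdicCompletion.isSemisimpleRing_quotient_idealExt 𝔐
  have := AdicCompletion.isAdicComplete_idealExt 𝔐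
  obtain ⟨E, _, _, hE⟩ := exists_isDualizing (𝔪 := AdicCompletion.idealExt 𝔐)
  have hsup : (a ⊔ b).map (algebraMap R (AdicCompletion 𝔐 R)) =
    a.map (algebraMap R (AdicCompletion 𝔐 R)) ⊔ b.map (algebraMap R (AdicCompletion 𝔐 R)) :=
    Ideal.map_sup _ _ _
  have hq (q : PrimeSpectrum (AdicCompletion 𝔐 R))
      (hq : a.map (algebraMap R (AdicCompletion 𝔐 R)) ⊔
        b.map (algebraMap R (AdicCompletion 𝔐 R)) ≤ q.asIdeal) :
      (a ⊔ b).map (algebraMap R (AdicCompletion 𝔐 R)) ≤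
        Module.annihilator (AdicCompletion 𝔐 R) (AdicCompletion 𝔐 R ⧸ q.asIdeal) := by
    rwa [hsup, Ideal.annihilator_quotient]
  obtain ⟨f, hf⟩ := exists_surjective_of_attachedPrimes hE (AdicCompletion 𝔐 R ⊗[R] M) d
    (DeltaFun.isSupported_restricted _ a) (DeltaFun.isSupported_restricted _ b)
    (hsup ▸ DeltaFun.isSupported_restricted _ (a ⊔ b))
    (DeltaHom.restricted _ le_sup_left) (DeltaHom.restricted _ le_sup_right)
    (fun q h => DeltaHom.bijective_restricted le_sup_left (hq q h))
    (fun q h => DeltaHom.bijective_restricted le_sup_right (hq q h))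
    (AdicCompletion.idealExt_le_of_isMaximal 𝔐) (Ideal.map_mono ha) (Ideal.map_mono hb)
    (fun p hp => AdicCompletion.coheight_le_of_mem_support 𝔐 hd p hp)
    (hcase.imp Ideal.map_mono fun h =>
      (attachedPrimes_eq_of_equiv ea).symm.subset.trans
        (h.trans (attachedPrimes_eq_of_equiv eb).subset))
  let g : TopLC R b d M →ₗ[R] TopLC R a d M :=
    (ea.symm.toLinearMap ∘ₗ f ∘ₗ eb.toLinearMap).restrictScalars R
  have hg : Function.Surjective g := ea.symm.surjective.comp (hf.comp eb.surjective)
  exact ⟨LinearMap.ker g, ⟨(g.quotKerEquivOfSurjective hg).symm⟩⟩
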